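/- Let F be a labelled finite simple graph with e(F) > 0 and m = |F| vertices, let 0 < p ≤ 1, and let α_1,…,α_m be positive reals with Σ_{i=1}^m α_i < 1. Then P(F;α_1,…,α_m) is a p-quasi-random property of graph sequences. -/

import Mathlib

open Filter Finset Asymptotics MeasureTheory

/-- `labCount F G U` is the number of injective graph homomorphisms `φ : F → G`
with `φ i ∈ U i` for every vertex `i` of `F` (the quantity `N(F,G;U₁,…,U_m)`). -/
noncomputable def labCount {m : ℕ} {β : Type} [Fintype β]
    (F : SimpleGraph (Fin m)) (G : SimpleGraph β) (U : Fin m → Finset β) : ℕ :=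
  Nat.card {φ : Fin m → β //
    Function.Injective φ ∧ (∀ i j, F.Adj i j → G.Adj (φ i) (φ j)) ∧ ∀ i, φ i ∈ U i}

/-- `totalCount F G` is the total number of injective graph homomorphisms `F → G`,
the quantity `N(F,G)`. -/
noncomputable def totalCount {m : ℕ} {β : Type} [Fintype β]
    (F : SimpleGraph (Fin m)) (G : SimpleGraph β) : ℕ :=
  Nat.card {φ : Fin m → β //
    Function.Injective φ ∧ ∀ i j, F.Adj i j → G.Adj (φ i) (φ j)}

/-- `symCount F G U` is `Ñ(F,G;U₁,…,U_m) = (1/m!) ∑_σ N(F,G;U_{σ(1)},…,U_{σ(m)})`. -/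
noncomputable def symCount {m : ℕ} {β : Type} [Fintype β]
    (F : SimpleGraph (Fin m)) (G : SimpleGraph β) (U : Fin m → Finset β) : ℝ :=
  ((m.factorial : ℝ))⁻¹ * ∑ σ : Equiv.Perm (Fin m), (labCount F G (fun i => U (σ i)) : ℝ)

/-- `numEdges F` is `e(F)`, the number of edges of `F`. -/
noncomputable def numEdges {m : ℕ} (F : SimpleGraph (Fin m)) : ℕ := Nat.card F.edgeSet

/-- A sequence of graphs `G n` on vertex sets `Fin (V n)` is `p`-quasi-random if, for every
finite simple graph `F`, `N(F,G_n) = p^(e F) |G_n|^(|F|) + o(|G_n|^(|F|))`. -/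
def IsQuasirandom (p : ℝ) (V : ℕ → ℕ) (G : ∀ n, SimpleGraph (Fin (V n))) : Prop :=
  ∀ (m : ℕ) (F : SimpleGraph (Fin m)),
    (fun n => (totalCount F (G n) : ℝ) - p ^ numEdges F * (V n : ℝ) ^ m)
      =o[atTop] (fun n => (V n : ℝ) ^ m)

/-- The property `P(F;α₁,…,α_m)`: `N(F,G_n;U₁,…,U_m) = p^(e F) ∏ |U_i| + o(|G_n|^m)`,
uniformly over all pairwise disjoint `U₁,…,U_m ⊆ V(G_n)` with `|U_i| = ⌊α_i |G_n|⌋`. -/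
def SatisfiesP {m : ℕ} (F : SimpleGraph (Fin m)) (p : ℝ) (α : Fin m → ℝ)
    (V : ℕ → ℕ) (G : ∀ n, SimpleGraph (Fin (V n))) : Prop :=
  ∃ ε : ℕ → ℝ, Tendsto ε atTop (nhds 0) ∧
    ∀ (n : ℕ) (U : Fin m → Finset (Fin (V n))),
      Pairwise (fun i j => Disjoint (U i) (U j)) →
      (∀ i, (U i).card = ⌊α i * (V n : ℝ)⌋₊) →
      |(labCount F (G n) U : ℝ) - p ^ numEdges F * ∏ i, ((U i).card : ℝ)|
        ≤ ε n * (V n : ℝ) ^ m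

/-- The property `P̃(F;α₁,…,α_m)`: as `SatisfiesP` but with the symmetrized count `Ñ`. -/
def SatisfiesPt {m : ℕ} (F : SimpleGraph (Fin m)) (p : ℝ) (α : Fin m → ℝ)
    (V : ℕ → ℕ) (G : ∀ n, SimpleGraph (Fin (V n))) : Prop :=
  ∃ ε : ℕ → ℝ, Tendsto ε atTop (nhds 0) ∧
    ∀ (n : ℕ) (U : Fin m → Finset (Fin (V n))),
      Pairwise (fun i j => Disjoint (U i) (U j)) →
      (∀ i, (U i).card = ⌊α i * (V n : ℝ)⌋₊) →
      |symCount F (G n) U - p ^ numEdges F * ∏ i, ((U i).card : ℝ)|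
        ≤ ε n * (V n : ℝ) ^ m

/-- The property `Pᵘ(F;α₁,…,α_m)`: `P` holds for every labelling of `F`. -/
def SatisfiesPu {m : ℕ} (F : SimpleGraph (Fin m)) (p : ℝ) (α : Fin m → ℝ)
    (V : ℕ → ℕ) (G : ∀ n, SimpleGraph (Fin (V n))) : Prop :=
  ∀ σ : Equiv.Perm (Fin m), SatisfiesP (SimpleGraph.map σ.toEmbedding F) p α V G

open scoped Classical in
/-- The adjacency indicator of a graph, with values in `{0, 1} ⊆ ℝ`. -/
noncomputable def adjInd {β : Type} (G : SimpleGraph β) (x y : β) : ℝ :=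
  if G.Adj x y then 1 else 0

open scoped Classical in
/-- The edges of a graph on `Fin m`, written as increasing pairs. -/
noncomputable def edgePairs {m : ℕ} (F : SimpleGraph (Fin m)) : Finset (Fin m × Fin m) :=
  univ.filter fun e => e.1 < e.2 ∧ F.Adj e.1 e.2

theorem adjInd_nonneg {β : Type} (G : SimpleGraph β) (x y : β) : 0 ≤ adjInd G x y := by
  unfold adjInd; split_ifs <;> norm_num

theorem adjInd_le_one {β : Type} (G : SimpleGraph β) (x y : β) : adjInd G x y ≤ 1 := by
  unfold adjInd; split_ifs <;> norm_num

theorem mem_edgePairs {m : ℕ} {F : SimpleGraph (Fin m)} {e : Fin m × Fin m} :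
    e ∈ edgePairs F ↔ e.1 < e.2 ∧ F.Adj e.1 e.2 := by
  simp [edgePairs]

theorem card_edgePairs {m : ℕ} (F : SimpleGraph (Fin m)) :
    (edgePairs F).card = numEdges F := by
  classical
  unfold numEdges
  rw [Nat.card_eq_fintype_card, ← SimpleGraph.edgeFinset_card]
  refine Finset.card_bij (fun e _ => s(e.1, e.2)) ?_ ?_ ?_
  · intro e he
    simpa using (mem_edgePairs.1 he).2
  · rintro ⟨a, b⟩ hab ⟨c, d⟩ hcd h
    have h1 := (mem_edgePairs.1 hab).1
    have h2 := (mem_edgePairs.1 hcd).1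
    simp only [Sym2.eq_iff] at h
    rcases h with ⟨rfl, rfl⟩ | ⟨rfl, rfl⟩
    · rfl
    · exact absurd h1 h2.asymm
  · intro e
    refine Sym2.ind (fun a b h => ?_) e
    have h' : F.Adj a b := by simpa using h
    rcases lt_trichotomy a b with hab | hab | hab
    · exact ⟨(a, b), mem_edgePairs.2 ⟨hab, h'⟩, rfl⟩
    · exact absurd hab h'.ne
    · exact ⟨(b, a), mem_edgePairs.2 ⟨hab, h'.symm⟩, Sym2.eq_swap⟩

/-- A product of adjacency indicators is the indicator of all the adjacencies. -/
theorem prod_adjInd {β : Type} {ι : Type*} (G : SimpleGraph β) (E : Finset (ι × ι))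
    (x : ι → β) [Decidable (∀ e ∈ E, G.Adj (x e.1) (x e.2))] :
    ∏ e ∈ E, adjInd G (x e.1) (x e.2) =
      if ∀ e ∈ E, G.Adj (x e.1) (x e.2) then 1 else 0 := by
  split_ifs with h
  · exact Finset.prod_eq_one fun e he => by simp [adjInd, h e he]
  · push Not at h
    obtain ⟨e, he, hne⟩ := h
    exact Finset.prod_eq_zero he (by simp [adjInd, hne])

theorem forall_mem_edgePairs {m : ℕ} {β : Type} (F : SimpleGraph (Fin m)) (G : SimpleGraph β)
    (x : Fin m → β) :
    (∀ e ∈ edgePairs F, G.Adj (x e.1) (x e.2)) ↔ ∀ i j, F.Adj i j → G.Adj (x i) (x j) := by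
  constructor
  · intro h i j hij
    rcases lt_trichotomy i j with hlt | heq | hlt
    · exact h (i, j) (mem_edgePairs.2 ⟨hlt, hij⟩)
    · exact absurd heq hij.ne
    · exact (h (j, i) (mem_edgePairs.2 ⟨hlt, hij.symm⟩)).symm
  · intro h e he
    exact h _ _ (mem_edgePairs.1 he).2

/-- The number of (not necessarily injective) homomorphisms `x` with `x i ∈ A i`, where `E` is the
set of edges of the source graph. -/
noncomputable def homSum {β : Type} {m : ℕ} (E : Finset (Fin m × Fin m)) (G : SimpleGraph β)
    (A : Fin m → Finset β) : ℝ :=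
  ∑ x ∈ Fintype.piFinset A, ∏ e ∈ E, adjInd G (x e.1) (x e.2)

theorem labCount_eq_homSum {m : ℕ} {β : Type} [Fintype β]
    (F : SimpleGraph (Fin m)) (G : SimpleGraph β) (U : Fin m → Finset β)
    (hU : Pairwise (fun i j => Disjoint (U i) (U j))) :
    (labCount F G U : ℝ) = homSum (edgePairs F) G U := by
  classical
  unfold labCount homSum
  simp_rw [prod_adjInd]
  rw [Finset.sum_boole, Nat.card_eq_fintype_card, Fintype.card_subtype]
  congr 2
  ext x
  simp only [mem_filter, mem_univ, true_and, Fintype.mem_piFinset, forall_mem_edgePairs]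
  constructor
  · rintro ⟨_, h1, h2⟩
    exact ⟨h2, h1⟩
  · rintro ⟨h2, h1⟩
    refine ⟨fun i j hij => ?_, h1, h2⟩
    by_contra hne
    exact Finset.disjoint_left.1 (hU hne) (h2 i) (hij ▸ h2 j)

/-- Resampling one coordinate of a sum over a product. -/
theorem card_mul_sum_piFinset {ι β : Type*} [Fintype ι] [DecidableEq ι]
    (A : ι → Finset β) (u : ι) (h : (ι → β) → ℝ) :
    ((A u).card : ℝ) * ∑ x ∈ Fintype.piFinset A, h x =
      ∑ x ∈ Fintype.piFinset A, ∑ s ∈ A u, h (Function.update x u s) := by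
  rw [← Finset.sum_product', ← nsmul_eq_mul, ← Finset.sum_const,
    Finset.sum_comm' (t' := Fintype.piFinset A) (s' := fun _ => A u) (by tauto),
    ← Finset.sum_product']
  refine Finset.sum_nbij' (fun q => (Function.update q.1 u q.2, q.1 u))
    (fun q => (Function.update q.1 u q.2, q.1 u)) ?_ ?_ ?_ ?_ ?_
  iterate 2
    rintro ⟨x, s⟩ hq
    simp only [mem_product, Fintype.mem_piFinset] at hq ⊢
    refine ⟨fun i => ?_, hq.1 u⟩
    by_cases hi : i = u
    · subst hi; simpa using hq.2
    · simpa [hi] using hq.1 i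
  iterate 2
    rintro ⟨x, s⟩ -
    simp
  rintro ⟨x, s⟩ -
  simp

/-- Resampling two coordinates of a sum over a product. -/
theorem card_mul_card_mul_sum_piFinset {ι β : Type*} [Fintype ι] [DecidableEq ι]
    (A : ι → Finset β) (u v : ι) (h : (ι → β) → ℝ) :
    ((A u).card : ℝ) * ((A v).card : ℝ) * ∑ x ∈ Fintype.piFinset A, h x =
      ∑ x ∈ Fintype.piFinset A, ∑ s ∈ A u, ∑ t ∈ A v,
        h (Function.update (Function.update x u s) v t) := by
  rw [mul_assoc, card_mul_sum_piFinset A v, card_mul_sum_piFinset A u]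

theorem abs_sum_piFinset_le_of_cut {m : ℕ} {β : Type} (G : SimpleGraph β)
    (E : Finset (Fin m × Fin m)) (hE : ∀ e ∈ E, e.1 < e.2) (A : Fin m → Finset β)
    (e₀ : Fin m × Fin m) (he₀ : e₀.1 < e₀.2) (he₀E : e₀ ∉ E) (d c : ℝ)
    (hcut : ∀ S ⊆ A e₀.1, ∀ T ⊆ A e₀.2,
      |∑ s ∈ S, ∑ t ∈ T, (adjInd G s t - d)| ≤ c * ((A e₀.1).card * (A e₀.2).card)) :
    |∑ x ∈ Fintype.piFinset A, (adjInd G (x e₀.1) (x e₀.2) - d) *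
      ∏ e ∈ E, adjInd G (x e.1) (x e.2)| ≤ c * ∏ i, ((A i).card : ℝ) := by
  classical
  obtain ⟨u, v⟩ := e₀
  simp only at he₀ hcut ⊢
  have huv : u ≠ v := he₀.ne
  by_cases hemp : ((A u).card : ℝ) * ((A v).card : ℝ) = 0
  · have h0 : ∏ i, ((A i).card : ℝ) = 0 := by
      rcases mul_eq_zero.1 hemp with h | h
      · exact Finset.prod_eq_zero (mem_univ u) h
      · exact Finset.prod_eq_zero (mem_univ v) h
    have h1 : Fintype.piFinset A = ∅ := by
      rw [← Finset.card_eq_zero, Fintype.card_piFinset]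
      exact_mod_cast h0
    simp [h0, h1]
  have hpos : 0 < ((A u).card : ℝ) * ((A v).card : ℝ) := lt_of_le_of_ne (by positivity) (Ne.symm hemp)
  refine le_of_mul_le_mul_left ?_ hpos
  rw [← abs_of_pos hpos, ← abs_mul, card_mul_card_mul_sum_piFinset, abs_of_pos hpos]
  refine (Finset.abs_sum_le_sum_abs _ _).trans ?_
  have key : ∀ z ∈ Fintype.piFinset A, |∑ s ∈ A u, ∑ t ∈ A v,
      (adjInd G (Function.update (Function.update z u s) v t u)
          (Function.update (Function.update z u s) v t v) - d) *
        ∏ e ∈ E, adjInd G (Function.update (Function.update z u s) v t e.1)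
          (Function.update (Function.update z u s) v t e.2)|
      ≤ c * ((A u).card * (A v).card) := by
    intro z _
    set S := (A u).filter fun s => ∀ e ∈ E, e.1 ≠ v → e.2 ≠ v →
      G.Adj (Function.update z u s e.1) (Function.update z u s e.2)
    set T := (A v).filter fun t => ∀ e ∈ E, e.1 ≠ u → e.2 ≠ u →
      G.Adj (Function.update z v t e.1) (Function.update z v t e.2)
    refine le_trans (le_of_eq ?_) (hcut S (Finset.filter_subset _ _) T (Finset.filter_subset _ _))
    congr 1
    rw [Finset.sum_filter]
    refine Finset.sum_congr rfl fun s _ => ?_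
    have hite : ∀ (P : Prop) [Decidable P] (f : β → ℝ), (if P then ∑ t ∈ A v, f t else 0) =
        ∑ t ∈ A v, if P then f t else 0 := by
      intro P _ f; split_ifs <;> simp
    rw [Finset.sum_filter, hite]
    refine Finset.sum_congr rfl fun t _ => ?_
    set x := Function.update (Function.update z u s) v t
    have hxu : x u = s := by simp [x, huv]
    have hxv : x v = t := by simp [x]
    have hx1 : ∀ i, i ≠ v → x i = Function.update z u s i := fun i hi => by simp [x, hi]
    have hx2 : ∀ i, i ≠ u → x i = Function.update z v t i := fun i hi => by
      by_cases hiv : i = v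
      · subst hiv; simp [x]
      · simp [x, hi, hiv]
    have hiff : (∀ e ∈ E, G.Adj (x e.1) (x e.2)) ↔
        (∀ e ∈ E, e.1 ≠ v → e.2 ≠ v →
          G.Adj (Function.update z u s e.1) (Function.update z u s e.2)) ∧
        (∀ e ∈ E, e.1 ≠ u → e.2 ≠ u →
          G.Adj (Function.update z v t e.1) (Function.update z v t e.2)) := by
      constructor
      · intro h
        refine ⟨fun e he h1 h2 => ?_, fun e he h1 h2 => ?_⟩
        · rw [← hx1 _ h1, ← hx1 _ h2]; exact h e he
        · rw [← hx2 _ h1, ← hx2 _ h2]; exact h e he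
      · rintro ⟨h1, h2⟩ e he
        have hlt := hE e he
        have hne : e ≠ (u, v) := fun h => he₀E (h ▸ he)
        by_cases hv : e.1 ≠ v ∧ e.2 ≠ v
        · rw [hx1 _ hv.1, hx1 _ hv.2]; exact h1 e he hv.1 hv.2
        · have hu : e.1 ≠ u ∧ e.2 ≠ u := by
            rw [not_and_or, not_not, not_not] at hv
            rw [Ne, Prod.ext_iff] at hne
            constructor <;> rintro rfl <;> rcases hv with rfl | rfl
            · exact huv rfl
            · exact hne ⟨rfl, rfl⟩
            · exact lt_asymm hlt he₀
            · exact huv rfl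
          rw [hx2 _ hu.1, hx2 _ hu.2]; exact h2 e he hu.1 hu.2
    rw [prod_adjInd, hxu, hxv]
    simp only [hiff]
    split_ifs <;> simp_all
  refine (Finset.sum_le_sum key).trans (le_of_eq ?_)
  rw [Finset.sum_const, Fintype.card_piFinset, nsmul_eq_mul]
  push_cast
  ring

/-- **Counting lemma**: if every pair `(A i, A j)` with `(i, j) ∈ E` is close in cut norm to having
constant density `d`, then homomorphisms are counted by the product of the densities. -/
theorem abs_homSum_sub_le {m : ℕ} {β : Type} (G : SimpleGraph β)
    (E : Finset (Fin m × Fin m)) (hE : ∀ e ∈ E, e.1 < e.2) (A : Fin m → Finset β)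
    (d : Fin m × Fin m → ℝ) (hd0 : ∀ e ∈ E, 0 ≤ d e) (hd1 : ∀ e ∈ E, d e ≤ 1) (c : ℝ)
    (hcut : ∀ e ∈ E, ∀ S ⊆ A e.1, ∀ T ⊆ A e.2,
      |∑ s ∈ S, ∑ t ∈ T, (adjInd G s t - d e)| ≤ c * ((A e.1).card * (A e.2).card)) :
    |homSum E G A - (∏ e ∈ E, d e) * ∏ i, ((A i).card : ℝ)| ≤
      E.card * c * ∏ i, ((A i).card : ℝ) := by
  classical
  have hcard : ∏ i, ((A i).card : ℝ) = ∑ x ∈ Fintype.piFinset A, 1 := by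
    simp [Fintype.card_piFinset]
  induction E using Finset.induction_on with
  | empty => simp [homSum, Fintype.card_piFinset]
  | insert e E he ih =>
    simp only [Finset.forall_mem_insert] at hE hd0 hd1 hcut
    have ih' := ih hE.2 hd0.2 hd1.2 hcut.2
    have h1 := abs_sum_piFinset_le_of_cut G E hE.2 A e hE.1 he (d e) c hcut.1
    have hsplit : homSum (insert e E) G A - (∏ e ∈ insert e E, d e) * ∏ i, ((A i).card : ℝ) =
        (∑ x ∈ Fintype.piFinset A, (adjInd G (x e.1) (x e.2) - d e) *
          ∏ e ∈ E, adjInd G (x e.1) (x e.2)) +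
        d e * (homSum E G A - (∏ e ∈ E, d e) * ∏ i, ((A i).card : ℝ)) := by
      simp only [homSum, Finset.prod_insert he, sub_mul, Finset.sum_sub_distrib, mul_sub,
        Finset.mul_sum]
      ring
    rw [hsplit, Finset.card_insert_of_notMem he]
    refine (abs_add_le _ _).trans ?_
    rw [abs_mul, abs_of_nonneg hd0.1]
    have h2 : d e * |homSum E G A - (∏ e ∈ E, d e) * ∏ i, ((A i).card : ℝ)| ≤
        1 * |homSum E G A - (∏ e ∈ E, d e) * ∏ i, ((A i).card : ℝ)| := by
      gcongr
      exact hd1.1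
    push_cast
    linarith

/-- Sampling two distinct coordinates of a function is uniform on pairs. -/
theorem card_sq_mul_card_filter_rel {ι β : Type*} [Fintype ι] [DecidableEq ι] [Fintype β]
    {u v : ι} (huv : u ≠ v) (R : β → β → Prop) [DecidableRel R] :
    (Fintype.card β : ℝ) ^ 2 * ((univ.filter fun x : ι → β => R (x u) (x v)).card : ℝ) =
      (Fintype.card β : ℝ) ^ Fintype.card ι *
        ((univ.filter fun q : β × β => R q.1 q.2).card : ℝ) := by
  have h := card_mul_card_mul_sum_piFinset (fun _ : ι => (univ : Finset β)) u v
    (fun x => if R (x u) (x v) then (1 : ℝ) else 0)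
  simp only [Function.update_self, Function.update_of_ne huv, Fintype.piFinset_univ] at h
  rw [Finset.sum_boole, Finset.sum_const, ← Fintype.sum_prod_type', Finset.sum_boole] at h
  simp only [card_univ, nsmul_eq_mul, Fintype.card_fun, Nat.cast_pow] at h
  rw [sq]
  exact h

theorem card_mul_abs_totalCount_sub_homSum_le {m : ℕ} {β : Type} [Fintype β]
    (F : SimpleGraph (Fin m)) (G : SimpleGraph β) :
    (Fintype.card β : ℝ) * |(totalCount F G : ℝ) - homSum (edgePairs F) G fun _ => univ| ≤
      (m : ℝ) ^ 2 * (Fintype.card β : ℝ) ^ m := by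
  classical
  rcases Nat.eq_zero_or_pos (Fintype.card β) with h0 | hpos
  · simp only [h0, Nat.cast_zero, zero_mul]; positivity
  have hn : (0 : ℝ) < Fintype.card β := by exact_mod_cast hpos
  have hhom : homSum (edgePairs F) G (fun _ => univ) =
      ((univ.filter fun x : Fin m → β => ∀ i j, F.Adj i j → G.Adj (x i) (x j)).card : ℝ) := by
    unfold homSum
    simp_rw [prod_adjInd]
    rw [Finset.sum_boole, Fintype.piFinset_univ]
    simp_rw [forall_mem_edgePairs]
  have htot : totalCount F G = (univ.filter fun x : Fin m → β =>
      Function.Injective x ∧ ∀ i j, F.Adj i j → G.Adj (x i) (x j)).card := by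
    unfold totalCount
    rw [Nat.card_eq_fintype_card, Fintype.card_subtype]
  have hle : totalCount F G ≤
      (univ.filter fun x : Fin m → β => ∀ i j, F.Adj i j → G.Adj (x i) (x j)).card := by
    rw [htot]
    exact Finset.card_le_card fun x hx => by simp_all
  have hge : (univ.filter fun x : Fin m → β => ∀ i j, F.Adj i j → G.Adj (x i) (x j)).card ≤
      totalCount F G + ∑ q ∈ (univ : Finset (Fin m)).offDiag,
        (univ.filter fun x : Fin m → β => x q.1 = x q.2).card := by
    rw [htot]
    refine le_trans (Finset.card_le_card ?_) ((Finset.card_union_le _ _).trans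
      (Nat.add_le_add_left Finset.card_biUnion_le _))
    intro x hx
    simp only [mem_filter, mem_univ, true_and, mem_union, mem_biUnion, mem_offDiag] at hx ⊢
    by_cases hinj : Function.Injective x
    · exact Or.inl ⟨hinj, hx⟩
    · simp only [Function.Injective, not_forall] at hinj
      obtain ⟨i, j, hij, hne⟩ := hinj
      exact Or.inr ⟨(i, j), hne, hij⟩
  have hdiag : ∀ q ∈ (univ : Finset (Fin m)).offDiag, (Fintype.card β : ℝ) *
      ((univ.filter fun x : Fin m → β => x q.1 = x q.2).card : ℝ) =
        (Fintype.card β : ℝ) ^ m := by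
    intro q hq
    have h := card_sq_mul_card_filter_rel (β := β) (mem_offDiag.1 hq).2.2 (fun a b => a = b)
    have hd : (univ.filter fun q : β × β => q.1 = q.2).card = Fintype.card β := by
      rw [← Finset.card_univ (α := β), ← Finset.diag_card (univ : Finset β)]
      congr 1
      ext q
      simp
    rw [hd, Fintype.card_fin, sq, mul_assoc, mul_comm _ (Fintype.card β : ℝ)] at h
    exact mul_left_cancel₀ hn.ne' h
  rw [hhom, abs_sub_comm, abs_of_nonneg (by rw [sub_nonneg]; exact_mod_cast hle)]
  have hge' : ((univ.filter fun x : Fin m → β => ∀ i j, F.Adj i j → G.Adj (x i) (x j)).card : ℝ) -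
      totalCount F G ≤ ∑ q ∈ (univ : Finset (Fin m)).offDiag,
        ((univ.filter fun x : Fin m → β => x q.1 = x q.2).card : ℝ) := by
    rw [sub_le_iff_le_add']
    exact_mod_cast hge
  refine (mul_le_mul_of_nonneg_left hge' hn.le).trans ?_
  rw [Finset.mul_sum, Finset.sum_congr rfl hdiag, Finset.sum_const, nsmul_eq_mul]
  gcongr
  rw [Finset.offDiag_card, Finset.card_univ, Fintype.card_fin, sq]
  exact_mod_cast Nat.sub_le _ _

/-- The sequence `G n` converges to the constant `p` in cut norm. -/
def CutQuasirandom (p : ℝ) (V : ℕ → ℕ) (G : ∀ n, SimpleGraph (Fin (V n))) : Prop :=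
  ∀ γ > 0, ∀ᶠ n in atTop, ∀ S T : Finset (Fin (V n)),
    |∑ s ∈ S, ∑ t ∈ T, (adjInd (G n) s t - p)| ≤ γ * (V n : ℝ) ^ 2

/-- The total number of injective homomorphisms differs from the number of all homomorphisms by a
lower order term. -/
theorem totalCount_sub_homSum_isLittleO {m : ℕ} (F : SimpleGraph (Fin m)) (V : ℕ → ℕ)
    (G : ∀ n, SimpleGraph (Fin (V n))) (hV : Tendsto V atTop atTop) :
    (fun n => (totalCount F (G n) : ℝ) - homSum (edgePairs F) (G n) fun _ => univ)
      =o[atTop] (fun n => (V n : ℝ) ^ m) := by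
  rw [isLittleO_iff]
  intro c hc
  have hV' : Tendsto (fun n => (V n : ℝ)) atTop atTop := tendsto_natCast_atTop_atTop.comp hV
  filter_upwards [hV'.eventually_ge_atTop ((m : ℝ) ^ 2 / c), hV'.eventually_gt_atTop 0]
    with n hn hn0
  have h := card_mul_abs_totalCount_sub_homSum_le F (G n)
  rw [Fintype.card_fin] at h
  rw [Real.norm_eq_abs, Real.norm_of_nonneg (by positivity)]
  refine le_of_mul_le_mul_left (h.trans ?_) hn0
  rw [div_le_iff₀ hc] at hn
  calc (m : ℝ) ^ 2 * (V n : ℝ) ^ m ≤ (V n * c) * (V n : ℝ) ^ m := by gcongr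
    _ = _ := by ring

theorem CutQuasirandom.isQuasirandom {p : ℝ} (hp0 : 0 ≤ p) (hp1 : p ≤ 1) {V : ℕ → ℕ}
    {G : ∀ n, SimpleGraph (Fin (V n))} (hV : Tendsto V atTop atTop)
    (h : CutQuasirandom p V G) : IsQuasirandom p V G := by
  intro m F
  have h1 : (fun n => homSum (edgePairs F) (G n) (fun _ => univ) -
      p ^ numEdges F * (V n : ℝ) ^ m) =o[atTop] (fun n => (V n : ℝ) ^ m) := by
    rw [isLittleO_iff]
    intro c hc
    filter_upwards [h (c / ((edgePairs F).card + 1)) (by positivity)] with n hn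
    have := abs_homSum_sub_le (G n) (edgePairs F) (fun e he => (mem_edgePairs.1 he).1)
      (fun _ => univ) (fun _ => p) (fun _ _ => hp0) (fun _ _ => hp1)
      (c / ((edgePairs F).card + 1))
      (fun e _ S _ T _ => by simpa [sq] using hn S T)
    simp only [Finset.prod_const, card_edgePairs, card_univ, Fintype.card_fin] at this
    rw [Real.norm_eq_abs, Real.norm_of_nonneg (by positivity)]
    refine this.trans ?_
    gcongr
    rw [mul_div_assoc', div_le_iff₀ (by positivity)]
    nlinarith
  refine ((totalCount_sub_homSum_isLittleO F V G hV).add h1).congr_left fun n => ?_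
  ring

theorem sum_sum_pow_four_le {β : Type} [Fintype β] (f : β → β → ℝ) (S T : Finset β) :
    (∑ s ∈ S, ∑ t ∈ T, f s t) ^ 4 ≤ (Fintype.card β : ℝ) ^ 4 *
      ∑ y, ∑ y', (∑ x, f x y * f x y') ^ 2 := by
  set n : ℝ := (Fintype.card β : ℝ) with hn
  have hS : (S.card : ℝ) ≤ n := by rw [hn]; exact_mod_cast S.card_le_univ
  have hT : (T.card : ℝ) ≤ n := by rw [hn]; exact_mod_cast T.card_le_univ
  set b := ∑ x, (∑ t ∈ T, f x t) ^ 2 with hb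
  have h1 : (∑ s ∈ S, ∑ t ∈ T, f s t) ^ 2 ≤ n * b := by
    refine sq_sum_le_card_mul_sum_sq.trans ?_
    refine mul_le_mul hS ?_ (Finset.sum_nonneg fun _ _ => sq_nonneg _) (by positivity)
    exact Finset.sum_le_sum_of_subset_of_nonneg (subset_univ _) fun _ _ _ => sq_nonneg _
  have hb2 : b = ∑ q ∈ T ×ˢ T, ∑ x, f x q.1 * f x q.2 := by
    rw [hb, Finset.sum_comm]
    refine Finset.sum_congr rfl fun x _ => ?_
    rw [sq, Finset.sum_mul_sum, Finset.sum_product]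
  have h2 : b ^ 2 ≤ n ^ 2 * ∑ y, ∑ y', (∑ x, f x y * f x y') ^ 2 := by
    rw [hb2, ← Fintype.sum_prod_type']
    refine sq_sum_le_card_mul_sum_sq.trans ?_
    refine mul_le_mul ?_ ?_ (Finset.sum_nonneg fun _ _ => sq_nonneg _) (by positivity)
    · rw [Finset.card_product, sq]; push_cast; gcongr
    · exact Finset.sum_le_sum_of_subset_of_nonneg (subset_univ _) fun _ _ _ => sq_nonneg _
  calc (∑ s ∈ S, ∑ t ∈ T, f s t) ^ 4 = ((∑ s ∈ S, ∑ t ∈ T, f s t) ^ 2) ^ 2 := by ring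
    _ ≤ (n * b) ^ 2 := by gcongr
    _ = n ^ 2 * b ^ 2 := by ring
    _ ≤ n ^ 2 * (n ^ 2 * ∑ y, ∑ y', (∑ x, f x y * f x y') ^ 2) := by gcongr
    _ = _ := by ring

/-- The edges of the `4`-cycle with parts `{0, 1}` and `{2, 3}`. -/
def fourCyclePairs : Finset (Fin 4 × Fin 4) := {(0, 2), (0, 3), (1, 2), (1, 3)}

theorem sum_univ_fin_succ_fun {β : Type} [Fintype β] {k : ℕ} (h : (Fin (k + 1) → β) → ℝ) :
    ∑ q, h q = ∑ a, ∑ q : Fin k → β, h (Fin.cons a q) := by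
  rw [← (Fin.consEquiv fun _ => β).sum_comp, Fintype.sum_prod_type]
  rfl

theorem sum_prod_fourCyclePairs {β : Type} [Fintype β] (f : β → β → ℝ) :
    ∑ q : Fin 4 → β, ∏ e ∈ fourCyclePairs, f (q e.1) (q e.2) =
      ∑ y, ∑ y', (∑ x, f x y * f x y') ^ 2 := by
  have hprod : ∀ q : Fin 4 → β, ∏ e ∈ fourCyclePairs, f (q e.1) (q e.2) =
      f (q 0) (q 2) * f (q 0) (q 3) * (f (q 1) (q 2) * f (q 1) (q 3)) := by
    intro q
    rw [fourCyclePairs, Finset.prod_insert (by decide), Finset.prod_insert (by decide),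
      Finset.prod_insert (by decide), Finset.prod_singleton]
    ring
  have hlhs : ∑ q : Fin 4 → β, ∏ e ∈ fourCyclePairs, f (q e.1) (q e.2) =
      ∑ x, ∑ x', ∑ y, ∑ y', f x y * f x y' * (f x' y * f x' y') := by
    simp only [hprod, sum_univ_fin_succ_fun, Finset.univ_unique, Finset.sum_singleton]
    rfl
  rw [hlhs]
  simp only [sq, Finset.sum_mul_sum]
  rw [← Fintype.sum_prod_type', ← Fintype.sum_prod_type']
  simp only [← Fintype.sum_prod_type']
  exact Fintype.sum_equiv
    (⟨fun q => (q.1.2, q.2, q.1.1.1, q.1.1.2), fun q => (((q.2.2.1, q.2.2.2), q.1), q.2.1),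
      fun _ => rfl, fun _ => rfl⟩ : ((β × β) × β) × β ≃ β × β × β × β) _ _ fun _ => rfl

theorem edgePairs_fromRel {m : ℕ} (A : Finset (Fin m × Fin m)) (hA : ∀ e ∈ A, e.1 < e.2) :
    edgePairs (SimpleGraph.fromRel fun i j => (i, j) ∈ A) = A := by
  ext ⟨i, j⟩
  simp only [mem_edgePairs, SimpleGraph.fromRel_adj]
  constructor
  · rintro ⟨h1, -, h2 | h2⟩
    · exact h2
    · exact absurd h1 (hA _ h2).asymm
  · intro h
    exact ⟨hA _ h, (hA _ h).ne, Or.inl h⟩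

theorem IsQuasirandom.homSum_isLittleO {p : ℝ} {V : ℕ → ℕ}
    {G : ∀ n, SimpleGraph (Fin (V n))} (hV : Tendsto V atTop atTop)
    (h : IsQuasirandom p V G) {m : ℕ} (A : Finset (Fin m × Fin m)) (hA : ∀ e ∈ A, e.1 < e.2) :
    (fun n => homSum A (G n) (fun _ => univ) - p ^ A.card * (V n : ℝ) ^ m)
      =o[atTop] (fun n => (V n : ℝ) ^ m) := by
  have h1 := totalCount_sub_homSum_isLittleO (.fromRel fun i j => (i, j) ∈ A) V G hV
  have h2 := h m (.fromRel fun i j => (i, j) ∈ A)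
  rw [← card_edgePairs] at h2
  rw [edgePairs_fromRel A hA] at h1 h2
  refine (h2.sub h1).congr_left fun n => ?_
  ring

theorem IsQuasirandom.cutQuasirandom {p : ℝ} {V : ℕ → ℕ}
    {G : ∀ n, SimpleGraph (Fin (V n))} (hV : Tendsto V atTop atTop)
    (h : IsQuasirandom p V G) : CutQuasirandom p V G := by
  classical
  intro γ hγ
  have hC : ∀ e ∈ fourCyclePairs, e.1 < e.2 := by decide
  have hexp : ∀ n, ∑ q : Fin 4 → Fin (V n), ∏ e ∈ fourCyclePairs,
      (adjInd (G n) (q e.1) (q e.2) - p) = ∑ A ∈ fourCyclePairs.powerset,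
        (-p) ^ (fourCyclePairs \ A).card *
          (homSum A (G n) (fun _ => univ) - p ^ A.card * (V n : ℝ) ^ 4) := by
    intro n
    have h0 : ∑ A ∈ fourCyclePairs.powerset,
        (-p) ^ (fourCyclePairs \ A).card * (p ^ A.card * (V n : ℝ) ^ 4) = 0 := by
      have := Finset.prod_add (fun _ : Fin 4 × Fin 4 => p) (fun _ => -p) fourCyclePairs
      simp only [Finset.prod_const] at this
      rw [add_neg_cancel, zero_pow (by decide)] at this
      calc _ = (∑ A ∈ fourCyclePairs.powerset, p ^ A.card * (-p) ^ (fourCyclePairs \ A).card) *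
            (V n : ℝ) ^ 4 := by
              rw [Finset.sum_mul]
              exact Finset.sum_congr rfl fun _ _ => by ring
        _ = 0 := by rw [← this, zero_mul]
    simp only [mul_sub, Finset.sum_sub_distrib, h0, sub_zero]
    simp only [sub_eq_add_neg, Finset.prod_add, Finset.prod_const]
    rw [Finset.sum_comm]
    refine Finset.sum_congr rfl fun A _ => ?_
    rw [homSum, Fintype.piFinset_univ, Finset.mul_sum]
    exact Finset.sum_congr rfl fun _ _ => mul_comm _ _
  have hsmall : (fun n => ∑ q : Fin 4 → Fin (V n), ∏ e ∈ fourCyclePairs,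
      (adjInd (G n) (q e.1) (q e.2) - p)) =o[atTop] (fun n => (V n : ℝ) ^ 4) := by
    simp_rw [hexp]
    refine IsLittleO.fun_sum fun A hA => IsLittleO.const_mul_left ?_ _
    exact h.homSum_isLittleO hV A fun e he => hC e (Finset.mem_powerset.1 hA he)
  rw [isLittleO_iff] at hsmall
  filter_upwards [hsmall (show 0 < γ ^ 4 by positivity)] with n hn S T
  have h4 := sum_sum_pow_four_le (fun s t => adjInd (G n) s t - p) S T
  rw [← sum_prod_fourCyclePairs, Fintype.card_fin] at h4
  rw [Real.norm_eq_abs, Real.norm_of_nonneg (by positivity)] at hn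
  have h5 := (le_abs_self _).trans hn
  refine le_of_pow_le_pow_left₀ (n := 4) (by norm_num) (by positivity) ?_
  rw [Even.pow_abs (by decide)]
  calc _ ≤ _ := h4
    _ ≤ (V n : ℝ) ^ 4 * (γ ^ 4 * (V n : ℝ) ^ 4) := by gcongr
    _ = _ := by ring

theorem exists_pos_forall_le {m : ℕ} (α : Fin m → ℝ) (hα : ∀ i, 0 < α i) :
    ∃ a > 0, ∀ i, a ≤ α i := by
  rcases isEmpty_or_nonempty (Fin m) with h | h
  · exact ⟨1, one_pos, fun i => (h.false i).elim⟩
  · obtain ⟨i, hi⟩ := Finite.exists_min α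
    exact ⟨α i, hα i, hi⟩

/-- A family of finitely many quantities for each `n`, eventually uniformly small, has a common
null sequence of bounds. -/
theorem exists_tendsto_zero_bound {ι : ℕ → Type} [∀ n, Finite (ι n)] (r : ∀ n, ι n → ℝ)
    (h0 : ∀ n U, 0 ≤ r n U) (hr : ∀ δ > 0, ∀ᶠ n in atTop, ∀ U, r n U ≤ δ) :
    ∃ ε : ℕ → ℝ, Tendsto ε atTop (nhds 0) ∧ ∀ n U, r n U ≤ ε n := by
  refine ⟨fun n => ⨆ U, r n U, ?_, fun n U => le_ciSup (Set.finite_range _).bddAbove U⟩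
  rw [Metric.tendsto_nhds]
  intro δ hδ
  filter_upwards [hr (δ / 2) (half_pos hδ)] with n hn
  rw [Real.dist_0_eq_abs, abs_of_nonneg (Real.iSup_nonneg (h0 n))]
  exact (Real.iSup_le hn (half_pos hδ).le).trans_lt (half_lt_self hδ)

theorem CutQuasirandom.eventually_labCount_le {p : ℝ} (hp0 : 0 ≤ p) (hp1 : p ≤ 1) {V : ℕ → ℕ}
    {G : ∀ n, SimpleGraph (Fin (V n))} (hV : Tendsto V atTop atTop)
    (h : CutQuasirandom p V G) {m : ℕ} (F : SimpleGraph (Fin m)) (α : Fin m → ℝ)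
    (hα : ∀ i, 0 < α i) :
    ∀ δ > 0, ∀ᶠ n in atTop, ∀ U : {U : Fin m → Finset (Fin (V n)) //
      Pairwise (fun i j => Disjoint (U i) (U j)) ∧ ∀ i, (U i).card = ⌊α i * (V n : ℝ)⌋₊},
      |(labCount F (G n) U.1 : ℝ) - p ^ numEdges F * ∏ i, ((U.1 i).card : ℝ)| /
        (V n : ℝ) ^ m ≤ δ := by
  classical
  obtain ⟨a, ha, haα⟩ := exists_pos_forall_le α hα
  have hV' : Tendsto (fun n => (V n : ℝ)) atTop atTop := tendsto_natCast_atTop_atTop.comp hV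
  intro δ hδ
  set c : ℝ := δ / ((edgePairs F).card + 1)
  have hc : 0 < c := by positivity
  filter_upwards [h (c * (a / 2) ^ 2) (by positivity), hV'.eventually_gt_atTop 0,
    hV'.eventually_ge_atTop (2 / a)] with n hn hn0 hna
  rintro ⟨U, hU, hUc⟩
  have hUa : ∀ i, a / 2 * V n ≤ ((U i).card : ℝ) := by
    intro i
    rw [hUc]
    have h1 := Nat.lt_floor_add_one (α i * (V n : ℝ))
    have h2 : a * V n ≤ α i * V n := by gcongr; exact haα i
    rw [div_le_iff₀ ha] at hna
    linarith
  rw [div_le_iff₀ (by positivity)]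
  simp only
  rw [labCount_eq_homSum F (G n) U hU]
  have hcount := abs_homSum_sub_le (G n) (edgePairs F) (fun e he => (mem_edgePairs.1 he).1)
    U (fun _ => p) (fun _ _ => hp0) (fun _ _ => hp1) c
    (fun e _ S _ T _ => (hn S T).trans (by
      have := mul_le_mul (hUa e.1) (hUa e.2) (by positivity) (by positivity)
      calc c * (a / 2) ^ 2 * (V n : ℝ) ^ 2 = c * (a / 2 * V n * (a / 2 * V n)) := by ring
        _ ≤ _ := by gcongr))
  rw [Finset.prod_const, card_edgePairs] at hcount
  refine hcount.trans ?_
  have hle : ∏ i, ((U i).card : ℝ) ≤ (V n : ℝ) ^ m := by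
    refine (Finset.prod_le_prod (fun _ _ => by positivity) fun i _ => ?_).trans
      (le_of_eq (by rw [Finset.prod_const, card_univ, Fintype.card_fin]))
    exact_mod_cast (Finset.card_le_univ _).trans_eq (Fintype.card_fin _)
  have hec : (numEdges F : ℝ) * c ≤ δ := by
    rw [mul_div_assoc', div_le_iff₀ (by positivity), card_edgePairs]
    nlinarith
  exact mul_le_mul hec hle (Finset.prod_nonneg fun _ _ => Nat.cast_nonneg _) hδ.le

theorem CutQuasirandom.satisfiesP {p : ℝ} (hp0 : 0 ≤ p) (hp1 : p ≤ 1) {V : ℕ → ℕ}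
    {G : ∀ n, SimpleGraph (Fin (V n))} (hV : Tendsto V atTop atTop)
    (h : CutQuasirandom p V G) {m : ℕ} (hm : m ≠ 0) (F : SimpleGraph (Fin m)) (α : Fin m → ℝ)
    (hα : ∀ i, 0 < α i) : SatisfiesP F p α V G := by
  obtain ⟨ε, hε, hb⟩ := exists_tendsto_zero_bound _ (fun n U => by positivity)
    (h.eventually_labCount_le hp0 hp1 hV F α hα)
  refine ⟨ε, hε, fun n U hU hc => ?_⟩
  rcases Nat.eq_zero_or_pos (V n) with h0 | hpos
  · have hUe : ∀ i, U i = ∅ := fun i => by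
      rw [← Finset.card_eq_zero, hc, h0]; simp
    have i₀ : Fin m := ⟨0, Nat.pos_of_ne_zero hm⟩
    rw [labCount_eq_homSum F (G n) U hU]
    have hpi : Fintype.piFinset U = ∅ := by
      rw [← Finset.card_eq_zero, Fintype.card_piFinset]
      exact Finset.prod_eq_zero (mem_univ i₀) (by simp [hUe])
    simp [homSum, hpi, h0, hm, hUe]
  · have : (0 : ℝ) < (V n : ℝ) ^ m := by positivity
    exact (div_le_iff₀ this).1 (hb n ⟨U, hU, hc⟩)

theorem injective_update {ι κ : Type*} [DecidableEq ι] {f : ι → κ} (hf : Function.Injective f)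
    (u : ι) {s : κ} (hs : ∀ i, i ≠ u → f i ≠ s) : Function.Injective (Function.update f u s) := by
  intro i j hij
  by_cases hi : i = u <;> by_cases hj : j = u
  · rw [hi, hj]
  · subst hi; simp only [Function.update_self, Function.update_of_ne hj] at hij
    exact absurd hij.symm (hs j hj)
  · subst hj; simp only [Function.update_self, Function.update_of_ne hi] at hij
    exact absurd hij (hs i hi)
  · simp only [Function.update_of_ne hi, Function.update_of_ne hj] at hij
    exact hf hij

theorem exists_injective_forall_notMem {m N : ℕ} (S : Finset (Fin N)) (h : m + S.card ≤ N) :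
    ∃ f : Fin m → Fin N, Function.Injective f ∧ ∀ i, f i ∉ S := by
  have hc : Fintype.card (Fin m) ≤ Fintype.card {x // x ∈ Sᶜ} := by
    rw [Fintype.card_fin, Fintype.card_coe, Finset.card_compl, Fintype.card_fin]
    omega
  obtain ⟨f⟩ := Function.Embedding.nonempty_of_card_le hc
  exact ⟨fun i => f i, fun i j hij => f.injective (Subtype.ext hij),
    fun i => Finset.mem_compl.1 (f i).2⟩

/-- If the edge weights of every copy of `E` in a complete graph on sufficiently many vertices sum
to zero, then every weight is zero. -/
theorem eq_zero_of_sum_copies_eq_zero {m N : ℕ} (hN : m + 4 ≤ N) (E : Finset (Fin m × Fin m))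
    (hE : ∀ e ∈ E, e.1 < e.2) (hne : E.Nonempty) (w : Fin N → Fin N → ℝ)
    (hw : ∀ a b, w a b = w b a)
    (h : ∀ ψ : Fin m → Fin N, Function.Injective ψ → ∑ e ∈ E, w (ψ e.1) (ψ e.2) = 0) :
    ∀ a b, a ≠ b → w a b = 0 := by
  obtain ⟨⟨u, v⟩, huvE⟩ := hne
  have huv : u < v := hE _ huvE
  have cross : ∀ a a' b b', a ≠ b → a ≠ b' → a' ≠ b → a' ≠ b' →
      w a b - w a' b - w a b' + w a' b' = 0 := by
    intro a a' b b' h1 h2 h3 h4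
    obtain ⟨ι, hι, hιS⟩ := exists_injective_forall_notMem (m := m) {a, a', b, b'}
      (by have := Finset.card_le_four (a := a) (b := a') (c := b) (d := b'); omega)
    simp only [mem_insert, mem_singleton, not_or] at hιS
    have hinj : ∀ s t, (s = a ∨ s = a') → (t = b ∨ t = b') →
        Function.Injective (Function.update (Function.update ι u s) v t) := by
      intro s t hs ht
      refine injective_update (injective_update hι u fun i _ => ?_) v fun i _ => ?_
      · rcases hs with rfl | rfl <;> simp [hιS]
      · by_cases hi : i = u
        · subst hi
          rw [Function.update_self]
          rcases hs with rfl | rfl <;> rcases ht with rfl | rfl <;> assumption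
        · rw [Function.update_of_ne hi]
          rcases ht with rfl | rfl <;> simp [hιS]
    have hsum : ∑ e ∈ E,
        (w (Function.update (Function.update ι u a) v b e.1)
            (Function.update (Function.update ι u a) v b e.2) -
          w (Function.update (Function.update ι u a') v b e.1)
            (Function.update (Function.update ι u a') v b e.2) -
          w (Function.update (Function.update ι u a) v b' e.1)
            (Function.update (Function.update ι u a) v b' e.2) +
          w (Function.update (Function.update ι u a') v b' e.1)
            (Function.update (Function.update ι u a') v b' e.2)) = 0 := by
      simp only [Finset.sum_add_distrib, Finset.sum_sub_distrib]
      rw [h _ (hinj a b (.inl rfl) (.inl rfl)), h _ (hinj a' b (.inr rfl) (.inl rfl)),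
        h _ (hinj a b' (.inl rfl) (.inr rfl)), h _ (hinj a' b' (.inr rfl) (.inr rfl))]
      ring
    rw [Finset.sum_eq_single (u, v)] at hsum
    · simpa [huv.ne] using hsum
    · rintro ⟨i, j⟩ he hne'
      have hlt : i < j := hE _ he
      by_cases hv : i ≠ v ∧ j ≠ v
      · simp only [Function.update_of_ne hv.1, Function.update_of_ne hv.2]
        ring
      · have hu : i ≠ u ∧ j ≠ u := by
          rw [not_and_or, not_not, not_not] at hv
          rw [Ne, Prod.ext_iff] at hne'
          constructor <;> rintro rfl <;> rcases hv with rfl | rfl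
          · exact huv.ne rfl
          · exact hne' ⟨rfl, rfl⟩
          · exact lt_asymm hlt huv
          · exact huv.ne rfl
        simp only [Function.update_comm huv.ne, Function.update_of_ne hu.1,
          Function.update_of_ne hu.2]
        ring
    · exact fun hn => absurd huvE hn
  have swap : ∀ a a' b, a ≠ b → a' ≠ b → w a b = w a' b := by
    intro a a' b h1 h2
    obtain ⟨ι, hι, hιS⟩ := exists_injective_forall_notMem (m := m) {a, a'}
      (by have := Finset.card_le_two (a := a) (b := a'); omega)
    simp only [mem_insert, mem_singleton, not_or] at hιS
    have hA := h _ (injective_update hι u (s := a) fun i _ => (hιS i).1)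
    have hA' := h _ (injective_update hι u (s := a') fun i _ => (hιS i).2)
    have hdiff : ∀ c, c ≠ a → c ≠ a' → w a c - w a' c = w a b - w a' b := by
      intro c hc hc'
      linarith [cross a a' b c h1 hc.symm h2 hc'.symm]
    have hsum : ∑ e ∈ E, (if e.1 = u ∨ e.2 = u then w a b - w a' b else 0) = 0 := by
      have hAA := hA.trans hA'.symm
      rw [← sub_eq_zero, ← Finset.sum_sub_distrib] at hAA
      refine Eq.trans (Finset.sum_congr rfl ?_) hAA
      rintro ⟨i, j⟩ he
      have hlt : i < j := hE _ he
      by_cases hi : i = u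
      · subst hi
        simp only [true_or, if_true, Function.update_self, Function.update_of_ne hlt.ne']
        exact (hdiff _ (hιS j).1 (hιS j).2).symm
      · by_cases hj : j = u
        · subst hj
          simp only [or_true, if_true, Function.update_self, Function.update_of_ne hlt.ne]
          rw [hw _ a, hw _ a']
          exact (hdiff _ (hιS i).1 (hιS i).2).symm
        · simp [hi, hj]
    rw [← Finset.sum_filter, Finset.sum_const, nsmul_eq_mul] at hsum
    rcases mul_eq_zero.1 hsum with h0 | h0
    · have : (u, v) ∈ E.filter fun e => e.1 = u ∨ e.2 = u := by simp [huvE]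
      rw [Nat.cast_eq_zero, Finset.card_eq_zero] at h0
      rw [h0] at this
      exact absurd this (notMem_empty _)
    · linarith
  intro a b hab
  have hconst : ∀ c d, c ≠ d → w c d = w a b := by
    intro c d hcd
    obtain ⟨y, -, hy⟩ := exists_injective_forall_notMem (m := 1) ({b, c} : Finset (Fin N))
      (by have := Finset.card_le_two (a := b) (b := c); omega)
    have hy := hy 0
    simp only [mem_insert, mem_singleton, not_or] at hy
    rw [hw c d, swap d (y 0) c hcd.symm hy.2, hw (y 0) c, swap c b (y 0) (Ne.symm hy.2)
      (Ne.symm hy.1), hw b, swap (y 0) a b hy.1 hab]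
  obtain ⟨ι, hι, -⟩ := exists_injective_forall_notMem (m := m) (∅ : Finset (Fin N))
    (by rw [Finset.card_empty]; omega)
  have h0 := h ι hι
  rw [Finset.sum_congr rfl fun e he => hconst _ _ (hι.ne (hE e he).ne), Finset.sum_const,
    nsmul_eq_mul] at h0
  rcases mul_eq_zero.1 h0 with h1 | h1
  · rw [Nat.cast_eq_zero, Finset.card_eq_zero] at h1
    rw [h1] at huvE
    exact absurd huvE (notMem_empty _)
  · exact h1

theorem eq_of_prod_copies_eq {m N : ℕ} (hN : m + 4 ≤ N) (E : Finset (Fin m × Fin m))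
    (hE : ∀ e ∈ E, e.1 < e.2) (hne : E.Nonempty) {p : ℝ} (hp : 0 < p) (D : Fin N → Fin N → ℝ)
    (hD : ∀ a b, D a b = D b a) (hD0 : ∀ a b, 0 ≤ D a b)
    (h : ∀ ψ : Fin m → Fin N, Function.Injective ψ →
      ∏ e ∈ E, D (ψ e.1) (ψ e.2) = p ^ E.card) :
    ∀ a b, a ≠ b → D a b = p := by
  have hprod : ∀ ψ : Fin m → Fin N, Function.Injective ψ → ∀ e ∈ E, D (ψ e.1) (ψ e.2) ≠ 0 := by
    intro ψ hψ e he h0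
    have := h ψ hψ
    rw [Finset.prod_eq_zero he h0] at this
    exact (pow_pos hp _).ne this
  have hpos : ∀ a b, a ≠ b → D a b ≠ 0 := by
    intro a b hab
    obtain ⟨⟨u, v⟩, he⟩ := hne
    have huv : u < v := hE _ he
    obtain ⟨ι, hι, hιS⟩ := exists_injective_forall_notMem (m := m) {a, b}
      (by have := Finset.card_le_two (a := a) (b := b); omega)
    simp only [mem_insert, mem_singleton, not_or] at hιS
    have := hprod (Function.update (Function.update ι u a) v b) (injective_update
      (injective_update hι u fun i _ => (hιS i).1) v fun i _ => by
        by_cases hi : i = u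
        · subst hi; simpa using hab
        · simpa [hi] using (hιS i).2) _ he
    simpa [huv.ne] using this
  intro a b hab
  have h0 := eq_zero_of_sum_copies_eq_zero hN E hE hne (fun a b => Real.log (D a b) - Real.log p)
    (fun a b => by rw [hD]) (fun ψ hψ => by
      rw [Finset.sum_sub_distrib, ← Real.log_prod (hprod ψ hψ), h ψ hψ, Real.log_pow,
        Finset.sum_const, nsmul_eq_mul, sub_self]) a b hab
  exact Real.log_injOn_pos (lt_of_le_of_ne (hD0 a b) (hpos a b hab).symm) hp (sub_eq_zero.1 h0)

/-- Stability version of `eq_of_prod_copies_eq`. -/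
theorem exists_forall_abs_sub_le {m : ℕ} (N : ℕ) (hN : m + 4 ≤ N) (E : Finset (Fin m × Fin m))
    (hE : ∀ e ∈ E, e.1 < e.2) (hne : E.Nonempty) {p : ℝ} (hp : 0 < p) {δ : ℝ} (hδ : 0 < δ) :
    ∃ ε > 0, ∀ D : Fin N → Fin N → ℝ, (∀ a b, D a b = D b a) → (∀ a b, 0 ≤ D a b) →
      (∀ a b, D a b ≤ 1) →
      (∀ ψ : Fin m → Fin N, Function.Injective ψ →
        |∏ e ∈ E, D (ψ e.1) (ψ e.2) - p ^ E.card| ≤ ε) →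
      ∀ a b, a ≠ b → |D a b - p| ≤ δ := by
  classical
  set C : Set (Fin N → Fin N → ℝ) := Set.Icc 0 1 ∩ {D | (∀ a b, D a b = D b a) ∧
    ∃ a b, a ≠ b ∧ δ ≤ |D a b - p|} with hC
  have hcont : ∀ a b, Continuous fun D : Fin N → Fin N → ℝ => D a b := fun a b => by fun_prop
  have hcpt : IsCompact C := by
    have heq : {D : Fin N → Fin N → ℝ | (∀ a b, D a b = D b a) ∧
        ∃ a b, a ≠ b ∧ δ ≤ |D a b - p|} = (⋂ a, ⋂ b, {D | D a b = D b a}) ∩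
        ⋃ a, ⋃ b, {D | a ≠ b ∧ δ ≤ |D a b - p|} := by
      ext D; simp
    rw [hC, heq]
    refine isCompact_Icc.inter_right ((isClosed_iInter fun a => isClosed_iInter fun b =>
      isClosed_eq (hcont a b) (hcont b a)).inter (isClosed_iUnion_of_finite fun a =>
      isClosed_iUnion_of_finite fun b => ?_))
    by_cases hab : a = b
    · simp [hab]
    · have heq' : {D : Fin N → Fin N → ℝ | a ≠ b ∧ δ ≤ |D a b - p|} =
          {D | δ ≤ |D a b - p|} := by
        simp [hab]
      rw [heq']
      exact isClosed_le continuous_const ((hcont a b).sub continuous_const).abs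
  set Φ : (Fin N → Fin N → ℝ) → ℝ := fun D =>
    ∑ ψ ∈ univ.filter (fun ψ : Fin m → Fin N => Function.Injective ψ),
      |∏ e ∈ E, D (ψ e.1) (ψ e.2) - p ^ E.card| with hΦ
  have hΦc : Continuous Φ := by fun_prop
  have hΦ0 : ∀ D ∈ C, 0 < Φ D := by
    rintro D ⟨⟨hD0, hD1⟩, hsymm, a, b, hab, hδab⟩
    refine lt_of_le_of_ne (Finset.sum_nonneg fun _ _ => abs_nonneg _) fun h0 => ?_
    rw [eq_comm, Finset.sum_eq_zero_iff_of_nonneg fun _ _ => abs_nonneg _] at h0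
    have := eq_of_prod_copies_eq hN E hE hne hp D hsymm (fun a b => hD0 a b)
      (fun ψ hψ => sub_eq_zero.1 (abs_eq_zero.1 (h0 ψ (by simpa using hψ)))) a b hab
    rw [this, sub_self, abs_zero] at hδab
    exact hδ.not_ge hδab
  obtain ⟨c, hc, hcΦ⟩ : ∃ c > 0, ∀ D ∈ C, c ≤ Φ D := by
    rcases C.eq_empty_or_nonempty with h | h
    · exact ⟨1, one_pos, by simp [h]⟩
    · obtain ⟨D, hD, hmin⟩ := hcpt.exists_isMinOn h hΦc.continuousOn
      exact ⟨Φ D, hΦ0 D hD, hmin⟩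
  set k : ℝ := ((univ.filter (fun ψ : Fin m → Fin N => Function.Injective ψ)).card : ℝ) with hk
  have hk0 : 0 ≤ k := Nat.cast_nonneg _
  refine ⟨c / (k + 1), by positivity, fun D hsymm h0 h1 hprod a b hab => ?_⟩
  by_contra hlt
  have hle := hcΦ D ⟨⟨fun a b => h0 a b, fun a b => h1 a b⟩, hsymm, a, b, hab, (not_le.1 hlt).le⟩
  have hub : Φ D ≤ k * (c / (k + 1)) := by
    rw [hΦ, hk, ← nsmul_eq_mul]
    exact Finset.sum_le_card_nsmul _ _ _ fun ψ hψ => hprod ψ (by simpa using hψ)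
  have : k * (c / (k + 1)) < c := by
    rw [mul_div_assoc', div_lt_iff₀ (by positivity)]
    nlinarith
  linarith

theorem exists_subset_card_eq_sum_le {β : Type*} (h : β → ℝ) (A : Finset β) (s : ℕ)
    (hs : s ≤ A.card) : ∃ T ⊆ A, T.card = s ∧ ∑ x ∈ T, h x ≤ max 0 (∑ x ∈ A, h x) := by
  classical
  induction A using Finset.strongInduction with
  | H A ih =>
    rcases hs.eq_or_lt with heq | hlt
    · exact ⟨A, Subset.rfl, heq.symm, le_max_right _ _⟩
    · have hA : A.Nonempty := Finset.card_pos.1 (by omega)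
      obtain ⟨x, hx, hmax⟩ := A.exists_max_image h hA
      obtain ⟨T, hT, hTs, hle⟩ := ih (A.erase x) (Finset.erase_ssubset hx)
        (by rw [Finset.card_erase_of_mem hx]; omega)
      refine ⟨T, hT.trans (Finset.erase_subset _ _), hTs, hle.trans (max_le (le_max_left _ _) ?_)⟩
      have hsum := Finset.add_sum_erase A h hx
      rcases le_total 0 (h x) with h0 | h0
      · exact le_max_of_le_right (by linarith)
      · exact le_max_of_le_left (Finset.sum_nonpos fun y hy =>
          (hmax y (Finset.mem_of_mem_erase hy)).trans h0)

theorem sum_le_of_forall_card_eq {β : Type*} (h : β → ℝ) (B : Finset β) {k s : ℕ}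
    (hsk : s ≤ k) (hB : k + s ≤ B.card) {M : ℝ}
    (hM : ∀ A ⊆ B, A.card = k → |∑ x ∈ A, h x| ≤ M) {S : Finset β} (hS : S ⊆ B)
    (hSs : S.card = s) : ∑ x ∈ S, h x ≤ 3 * M := by
  classical
  obtain ⟨A', hA'B, hA'⟩ := Finset.exists_subset_card_eq (s := B \ S) (n := k)
    (by rw [Finset.card_sdiff_of_subset hS]; omega)
  obtain ⟨T, hTA, hTs, hT⟩ := exists_subset_card_eq_sum_le h A' s (by omega)
  have hdisj : Disjoint (A' \ T) S := Finset.disjoint_of_subset_left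
    (Finset.sdiff_subset.trans hA'B) Finset.sdiff_disjoint
  have h1 := hM A' (hA'B.trans Finset.sdiff_subset) hA'
  have h2 := hM ((A' \ T) ∪ S) (Finset.union_subset
    ((Finset.sdiff_subset.trans hA'B).trans Finset.sdiff_subset) hS) (by
      rw [Finset.card_union_of_disjoint hdisj, Finset.card_sdiff_of_subset hTA]; omega)
  rw [Finset.sum_union hdisj] at h2
  have h3 := Finset.sum_sdiff (f := h) hTA
  have h4 : max 0 (∑ x ∈ A', h x) ≤ M := max_le ((abs_nonneg _).trans h1) ((le_abs_self _).trans h1)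
  rw [abs_le] at h1 h2
  linarith

/-- If all `k`-subsets of `B` have small sum, so do the smaller subsets. -/
theorem abs_sum_le_of_forall_card_eq {β : Type*} (h : β → ℝ) (B : Finset β) {k s : ℕ}
    (hsk : s ≤ k) (hB : k + s ≤ B.card) {M : ℝ}
    (hM : ∀ A ⊆ B, A.card = k → |∑ x ∈ A, h x| ≤ M) {S : Finset β} (hS : S ⊆ B)
    (hSs : S.card = s) : |∑ x ∈ S, h x| ≤ 3 * M := by
  refine abs_le'.2 ⟨sum_le_of_forall_card_eq h B hsk hB hM hS hSs, ?_⟩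
  rw [← Finset.sum_neg_distrib]
  refine sum_le_of_forall_card_eq (fun x => -h x) B hsk hB (fun A hA hAk => ?_) hS hSs
  rw [Finset.sum_neg_distrib, abs_neg]
  exact hM A hA hAk

theorem sum_piFinset_update {ι β : Type*} [Fintype ι] [DecidableEq ι] (U : ι → Finset β) (j : ι)
    (A : Finset β) (h : (ι → β) → ℝ) :
    ∑ x ∈ Fintype.piFinset (Function.update U j A), h x =
      ∑ y ∈ A, ∑ x ∈ Fintype.piFinset (Function.update U j {y}), h x := by
  classical
  rw [← Finset.sum_fiberwise_of_maps_to (t := A) (g := fun x => x j)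
    (fun x hx => by simpa using Fintype.mem_piFinset.1 hx j)]
  refine Finset.sum_congr rfl fun y hy => Finset.sum_congr ?_ fun _ _ => rfl
  ext x
  simp only [mem_filter, Fintype.mem_piFinset]
  constructor
  · rintro ⟨h1, h2⟩ i
    by_cases hi : i = j
    · subst hi; simp [h2]
    · simpa [hi] using h1 i
  · intro h1
    have hj : x j = y := by simpa using h1 j
    refine ⟨fun i => ?_, hj⟩
    by_cases hi : i = j
    · subst hi; simpa [hj] using hy
    · simpa [hi] using h1 i

/-- Smallness of box sums over disjoint sets of prescribed sizes `k i` passes to small boxes. -/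
theorem abs_sum_piFinset_le_of_card_le {m : ℕ} {β : Type} [Fintype β] (h : (Fin m → β) → ℝ)
    (k : Fin m → ℕ) (t : ℕ) (htk : ∀ i, t ≤ k i) (hk : ∑ i, k i + t ≤ Fintype.card β) {M : ℝ}
    (hM : ∀ U : Fin m → Finset β, Pairwise (fun i j => Disjoint (U i) (U j)) →
      (∀ i, (U i).card = k i) → |∑ x ∈ Fintype.piFinset U, h x| ≤ M)
    (J : Finset (Fin m)) : ∀ U : Fin m → Finset β, Pairwise (fun i j => Disjoint (U i) (U j)) →
      (∀ i ∈ J, (U i).card ≤ t) → (∀ i ∉ J, (U i).card = k i) →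
      |∑ x ∈ Fintype.piFinset U, h x| ≤ 3 ^ J.card * M := by
  classical
  induction J using Finset.induction_on with
  | empty =>
    intro U hU _ hc
    simpa using hM U hU fun i => hc i (notMem_empty _)
  | insert j J hj ih =>
    intro U hU hle hc
    set B : Finset β := univ \ (univ.erase j).biUnion U with hB
    have hUk : ∀ i, (U i).card ≤ k i := fun i => by
      by_cases hi : i ∈ insert j J
      · exact (hle i hi).trans (htk i)
      · exact (hc i hi).le
    have hBcard : k j + t ≤ B.card := by
      have h1 : ((univ.erase j).biUnion U).card ≤ ∑ i ∈ univ.erase j, k i :=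
        Finset.card_biUnion_le.trans (Finset.sum_le_sum fun i _ => hUk i)
      have h2 := Finset.add_sum_erase univ k (mem_univ j)
      rw [hB, Finset.card_sdiff_of_subset (subset_univ _), Finset.card_univ]
      omega
    have hBdisj : ∀ A ⊆ B, ∀ i, i ≠ j → Disjoint A (U i) := by
      intro A hA i hi
      rw [Finset.disjoint_left]
      intro x hx hxU
      have := hA hx
      rw [hB, Finset.mem_sdiff, mem_biUnion] at this
      exact this.2 ⟨i, by simp [hi], hxU⟩
    have hUj : U j ⊆ B := by
      intro x hx
      rw [hB, Finset.mem_sdiff, mem_biUnion]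
      refine ⟨mem_univ _, ?_⟩
      rintro ⟨i, hi, hxi⟩
      exact Finset.disjoint_left.1 (hU (Finset.ne_of_mem_erase hi)) hxi hx
    have hmain := abs_sum_le_of_forall_card_eq
      (fun y => ∑ x ∈ Fintype.piFinset (Function.update U j {y}), h x) B
      ((hle j (mem_insert_self _ _)).trans (htk j))
      ((Nat.add_le_add_left (hle j (mem_insert_self _ _)) _).trans hBcard)
      (M := 3 ^ J.card * M) (fun A hA hAk => by
        rw [← sum_piFinset_update]
        refine ih _ ?_ ?_ ?_
        · intro a b hab
          by_cases ha : a = j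
          · subst ha
            simpa [hab.symm] using hBdisj A hA b hab.symm
          · by_cases hb : b = j
            · subst hb
              simpa [hab] using (hBdisj A hA a hab).symm
            · simpa [ha, hb] using hU hab
        · intro i hi
          have hij : i ≠ j := fun h => hj (h ▸ hi)
          simpa [hij] using hle i (mem_insert_of_mem hi)
        · intro i hi
          by_cases hij : i = j
          · subst hij; simpa using hAk
          · simpa [hij] using hc i (by simp [hij, hi])) hUj rfl
    rw [← sum_piFinset_update, Function.update_eq_self] at hmain
    rw [Finset.card_insert_of_notMem hj, pow_succ]
    linarith

theorem sum_sum_adjInd {β : Type} (G : SimpleGraph β) [DecidableRel G.Adj] (S T : Finset β) :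
    ∑ s ∈ S, ∑ t ∈ T, adjInd G s t = G.edgeDensity S T * (S.card * T.card) := by
  have h : ∑ s ∈ S, ∑ t ∈ T, adjInd G s t = ((G.interedges S T).card : ℝ) := by
    rw [← Finset.sum_product', SimpleGraph.interedges, Rel.interedges, ← Finset.sum_boole]
    exact Finset.sum_congr rfl fun _ _ => by simp [adjInd]
  rw [h, SimpleGraph.edgeDensity_def]
  push_cast
  by_cases h0 : (S.card : ℝ) * T.card = 0
  · have := G.card_interedges_le_mul S T
    have h1 : ((G.interedges S T).card : ℝ) ≤ S.card * T.card := by exact_mod_cast this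
    have h2 : (0 : ℝ) ≤ (G.interedges S T).card := Nat.cast_nonneg _
    rw [h0] at h1 ⊢
    linarith
  · rw [div_mul_cancel₀ _ h0]

theorem abs_sum_sum_adjInd_sub_edgeDensity_le {β : Type} (G : SimpleGraph β) [DecidableRel G.Adj]
    {ε : ℝ} {A B : Finset β} (h : G.IsUniform ε A B) {S T : Finset β} (hS : S ⊆ A)
    (hT : T ⊆ B) :
    |∑ s ∈ S, ∑ t ∈ T, (adjInd G s t - G.edgeDensity A B)| ≤ ε * (A.card * B.card) := by
  have hε := h.pos
  have hSA : (S.card : ℝ) ≤ A.card := by exact_mod_cast Finset.card_le_card hS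
  have hTB : (T.card : ℝ) ≤ B.card := by exact_mod_cast Finset.card_le_card hT
  have heq : ∑ s ∈ S, ∑ t ∈ T, (adjInd G s t - G.edgeDensity A B) =
      ((G.edgeDensity S T : ℝ) - G.edgeDensity A B) * (S.card * T.card) := by
    simp only [Finset.sum_sub_distrib, sum_sum_adjInd, Finset.sum_const, nsmul_eq_mul]
    ring
  rw [heq, abs_mul, abs_of_nonneg (a := (S.card : ℝ) * T.card) (by positivity)]
  have hd : |(G.edgeDensity S T : ℝ) - G.edgeDensity A B| ≤ 1 := by
    have h1 : (0 : ℝ) ≤ G.edgeDensity S T := by exact_mod_cast G.edgeDensity_nonneg S T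
    have h2 : (0 : ℝ) ≤ G.edgeDensity A B := by exact_mod_cast G.edgeDensity_nonneg A B
    have h3 : (G.edgeDensity S T : ℝ) ≤ 1 := by exact_mod_cast G.edgeDensity_le_one S T
    have h4 : (G.edgeDensity A B : ℝ) ≤ 1 := by exact_mod_cast G.edgeDensity_le_one A B
    rw [abs_le]; constructor <;> linarith
  by_cases h1 : (A.card : ℝ) * ε ≤ S.card
  · by_cases h2 : (B.card : ℝ) * ε ≤ T.card
    · have := (h hS hT h1 h2).le
      gcongr
    · calc _ ≤ 1 * ((A.card : ℝ) * (B.card * ε)) := by gcongr; exact (not_le.1 h2).le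
        _ = _ := by ring
  · calc _ ≤ 1 * ((A.card * ε) * (B.card : ℝ)) := by gcongr; exact (not_le.1 h1).le
      _ = _ := by ring

/-- Most pairs extend to families of size `N` avoiding a sparse relation `bad`. -/
theorem card_filter_not_exists_extension_le {I : Type*} [Fintype I] [Nonempty I] {N : ℕ}
    {u v : Fin N} (huv : u ≠ v) (bad : I → I → Prop) [DecidableRel bad]
    [DecidablePred fun q : I × I => ¬ ∃ φ : Fin N → I, φ u = q.1 ∧ φ v = q.2 ∧
      ∀ a b, a ≠ b → ¬ bad (φ a) (φ b)] :
    ((univ.filter fun q : I × I => ¬ ∃ φ : Fin N → I, φ u = q.1 ∧ φ v = q.2 ∧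
      ∀ a b, a ≠ b → ¬ bad (φ a) (φ b)).card : ℝ) ≤
      (N : ℝ) ^ 2 * ((univ.filter fun q : I × I => bad q.1 q.2).card : ℝ) := by
  classical
  set R : I → I → Prop := fun i j => ¬ ∃ φ : Fin N → I, φ u = i ∧ φ v = j ∧
      ∀ a b, a ≠ b → ¬ bad (φ a) (φ b) with hR
  set K : ℝ := (Fintype.card I : ℝ) with hK
  have hK0 : 0 < K := by rw [hK]; exact_mod_cast Fintype.card_pos
  have h1 := card_sq_mul_card_filter_rel (β := I) huv R
  have h2 : ((univ.filter fun φ : Fin N → I => R (φ u) (φ v)).card : ℝ) ≤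
      ∑ q ∈ (univ : Finset (Fin N)).offDiag,
        ((univ.filter fun φ : Fin N → I => bad (φ q.1) (φ q.2)).card : ℝ) := by
    rw [← Nat.cast_sum, Nat.cast_le]
    refine le_trans (Finset.card_le_card ?_) Finset.card_biUnion_le
    intro φ hφ
    simp only [hR, mem_filter, mem_univ, true_and, not_exists, mem_biUnion, mem_offDiag] at hφ ⊢
    have := hφ φ
    simp only [true_and, not_forall, not_not] at this
    obtain ⟨a, b, hab, hbad⟩ := this
    exact ⟨(a, b), hab, hbad⟩
  have h3 : K ^ 2 * ∑ q ∈ (univ : Finset (Fin N)).offDiag,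
        ((univ.filter fun φ : Fin N → I => bad (φ q.1) (φ q.2)).card : ℝ) ≤
      (N : ℝ) ^ 2 * (K ^ N * ((univ.filter fun q : I × I => bad q.1 q.2).card : ℝ)) := by
    rw [Finset.mul_sum, Finset.sum_congr rfl fun q hq =>
      card_sq_mul_card_filter_rel (β := I) (mem_offDiag.1 hq).2.2 bad, Finset.sum_const,
      nsmul_eq_mul, Fintype.card_fin]
    gcongr
    rw [Finset.offDiag_card, Finset.card_univ, Fintype.card_fin, sq]
    exact_mod_cast Nat.sub_le _ _
  rw [Fintype.card_fin] at h1
  have hKN : 0 < K ^ N := by positivity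
  refine le_of_mul_le_mul_left ?_ hKN
  calc _ = _ := by congr!
    _ = _ := h1.symm
    _ ≤ _ := mul_le_mul_of_nonneg_left h2 (by positivity)
    _ ≤ _ := h3
    _ = _ := by ring

theorem sum_eq_sum_filter_part {β : Type} [Fintype β] [DecidableEq β]
    (P : Finpartition (univ : Finset β)) (S : Finset β) (f : β → ℝ) :
    ∑ s ∈ S, f s = ∑ A ∈ P.parts, ∑ s ∈ S.filter (fun s => P.part s = A), f s :=
  (Finset.sum_fiberwise_of_maps_to (fun s _ => P.part_mem.2 (mem_univ s)) f).symm

theorem abs_sum_sum_le_of_partition {β : Type} [Fintype β] [DecidableEq β]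
    (P : Finpartition (univ : Finset β)) (f : β → β → ℝ) (c : Finset β → Finset β → ℝ)
    (h : ∀ A ∈ P.parts, ∀ B ∈ P.parts, ∀ S ⊆ A, ∀ T ⊆ B, |∑ s ∈ S, ∑ t ∈ T, f s t| ≤ c A B)
    (S T : Finset β) :
    |∑ s ∈ S, ∑ t ∈ T, f s t| ≤ ∑ A ∈ P.parts, ∑ B ∈ P.parts, c A B := by
  have hsub : ∀ (S : Finset β) (A : Finset β), S.filter (fun s => P.part s = A) ⊆ A := by
    intro S A s hs
    rw [← (mem_filter.1 hs).2]
    exact P.mem_part (mem_univ s)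
  have heq : ∑ s ∈ S, ∑ t ∈ T, f s t = ∑ A ∈ P.parts, ∑ B ∈ P.parts,
      ∑ s ∈ S.filter (fun s => P.part s = A), ∑ t ∈ T.filter (fun t => P.part t = B), f s t := by
    rw [sum_eq_sum_filter_part P S]
    refine Finset.sum_congr rfl fun A _ => ?_
    rw [Finset.sum_comm, sum_eq_sum_filter_part P T]
    exact Finset.sum_congr rfl fun B _ => Finset.sum_comm
  rw [heq]
  exact (Finset.abs_sum_le_sum_abs _ _).trans (Finset.sum_le_sum fun A hA =>
    (Finset.abs_sum_le_sum_abs _ _).trans (Finset.sum_le_sum fun B hB =>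
      h A hA B hB _ (hsub S A) _ (hsub T B)))

theorem card_filter_eq_or_not_isUniform_le {β : Type} [Fintype β] [DecidableEq β]
    (G : SimpleGraph β) [DecidableRel G.Adj] (P : Finpartition (univ : Finset β)) {ε : ℝ}
    (hP : P.IsUniform G ε) (hK : 1 ≤ ε * P.parts.card)
    [DecidablePred fun q : P.parts × P.parts => q.1 = q.2 ∨ ¬ G.IsUniform ε q.1.1 q.2.1] :
    ((univ.filter fun q : P.parts × P.parts =>
      q.1 = q.2 ∨ ¬ G.IsUniform ε q.1.1 q.2.1).card : ℝ) ≤ 2 * ε * (P.parts.card : ℝ) ^ 2 := by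
  have hK0 : (0 : ℝ) ≤ P.parts.card := Nat.cast_nonneg _
  have hε : 0 ≤ ε := by
    by_contra hneg
    nlinarith [mul_nonneg (neg_nonneg.2 (not_le.1 hneg).le) hK0]
  have h1 : (univ.filter fun q : P.parts × P.parts =>
      q.1 = q.2 ∨ ¬ G.IsUniform ε q.1.1 q.2.1).card ≤
      (P.parts.diag ∪ P.nonUniforms G ε).card := by
    refine Finset.card_le_card_of_injOn (fun q => (q.1.1, q.2.1)) ?_ ?_
    · rintro ⟨A, B⟩ hq
      rcases eq_or_ne A B with rfl | hne
      · simp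
      · have hu : ¬ G.IsUniform ε A.1 B.1 := by
          simpa [hne] using hq
        have hne' : A.1 ≠ B.1 := fun h => hne (Subtype.ext h)
        exact mem_coe.2 (mem_union_right _
          ((P.mk_mem_nonUniforms G).2 ⟨A.2, B.2, hne', hu⟩))
    · rintro ⟨A, B⟩ _ ⟨A', B'⟩ _ h
      rw [Prod.mk.injEq] at h
      exact Prod.ext (Subtype.ext h.1) (Subtype.ext h.2)
  have h2 : ((P.parts.diag ∪ P.nonUniforms G ε).card : ℝ) ≤
      P.parts.card + (P.nonUniforms G ε).card := by
    rw [← Finset.diag_card P.parts]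
    exact_mod_cast Finset.card_union_le _ _
  have h3 : ((P.parts.card * (P.parts.card - 1) : ℕ) : ℝ) ≤ (P.parts.card : ℝ) ^ 2 := by
    rw [sq]
    exact_mod_cast Nat.mul_le_mul_left _ (Nat.sub_le _ _)
  have h4 : ((univ.filter fun q : P.parts × P.parts =>
      q.1 = q.2 ∨ ¬ G.IsUniform ε q.1.1 q.2.1).card : ℝ) ≤
      (P.parts.diag ∪ P.nonUniforms G ε).card := by exact_mod_cast h1
  have h5 : ((P.nonUniforms G ε).card : ℝ) ≤ (P.parts.card : ℝ) ^ 2 * ε :=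
    le_trans hP (mul_le_mul_of_nonneg_right h3 hε)
  nlinarith [mul_le_mul_of_nonneg_right hK hK0]

theorem abs_sum_sum_adjInd_sub_le_card {β : Type} (G : SimpleGraph β) {p : ℝ} (hp0 : 0 ≤ p)
    (hp1 : p ≤ 1) {A B S T : Finset β} (hS : S ⊆ A) (hT : T ⊆ B) :
    |∑ s ∈ S, ∑ t ∈ T, (adjInd G s t - p)| ≤ A.card * B.card := by
  have hST : |∑ s ∈ S, ∑ t ∈ T, (adjInd G s t - p)| ≤ ∑ s ∈ S, ∑ t ∈ T, (1 : ℝ) :=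
    (Finset.abs_sum_le_sum_abs _ _).trans (Finset.sum_le_sum fun s _ =>
      (Finset.abs_sum_le_sum_abs _ _).trans (Finset.sum_le_sum fun t _ => abs_le.2
        ⟨by linarith [adjInd_nonneg G s t], by linarith [adjInd_le_one G s t]⟩))
  refine hST.trans ?_
  simp only [Finset.sum_const, nsmul_eq_mul, mul_one]
  exact_mod_cast Nat.mul_le_mul (Finset.card_le_card hS) (Finset.card_le_card hT)

/-- In a regular partition, if the density of every pair of parts that extends to `N` pairwise
regular parts is close to `p`, then `G` is close to `p` in cut norm. -/
theorem abs_sum_sum_adjInd_sub_le_of_isUniform {β : Type} [Fintype β] [DecidableEq β]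
    (G : SimpleGraph β) [DecidableRel G.Adj] (P : Finpartition (univ : Finset β)) {ε δ p : ℝ}
    (hP : P.IsUniform G ε) (hK : 1 ≤ ε * P.parts.card) (hδ : 0 ≤ δ)
    (hp0 : 0 ≤ p) (hp1 : p ≤ 1)
    (hcard : ∀ A ∈ P.parts, (A.card : ℝ) * P.parts.card ≤ 2 * Fintype.card β)
    {N : ℕ} {u v : Fin N} (huv : u ≠ v)
    (hφ : ∀ φ : Fin N → Finset β, (∀ a, φ a ∈ P.parts) →
      (∀ a b, a ≠ b → φ a ≠ φ b ∧ G.IsUniform ε (φ a) (φ b)) →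
      |(G.edgeDensity (φ u) (φ v) : ℝ) - p| ≤ δ) (S T : Finset β) :
    |∑ s ∈ S, ∑ t ∈ T, (adjInd G s t - p)| ≤
      (ε + δ + 8 * (N : ℝ) ^ 2 * ε) * (Fintype.card β : ℝ) ^ 2 := by
  classical
  set K : ℝ := (P.parts.card : ℝ) with hKdef
  set n : ℝ := (Fintype.card β : ℝ) with hn
  have hK1 : (0 : ℝ) ≤ K := Nat.cast_nonneg _
  have hK0 : 0 < K := by
    refine lt_of_le_of_ne hK1 fun h => ?_
    rw [← h] at hK
    norm_num at hK
  have hε : 0 < ε := by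
    by_contra hneg
    nlinarith [mul_nonneg (neg_nonneg.2 (not_lt.1 hneg)) hK1]
  have : Nonempty P.parts := by
    rw [hKdef, Nat.cast_pos, Finset.card_pos] at hK0
    exact hK0.to_subtype
  set bad : P.parts → P.parts → Prop := fun A B => A = B ∨ ¬ G.IsUniform ε A.1 B.1 with hbad
  set R : P.parts × P.parts → Prop := fun q => ¬ ∃ φ : Fin N → P.parts, φ u = q.1 ∧ φ v = q.2 ∧
    ∀ a b, a ≠ b → ¬ bad (φ a) (φ b) with hR
  have hRcard : ((univ.filter R).card : ℝ) ≤ (N : ℝ) ^ 2 * (2 * ε * K ^ 2) := by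
    refine (card_filter_not_exists_extension_le huv bad).trans ?_
    gcongr
    exact card_filter_eq_or_not_isUniform_le G P hP hK
  have hsmall : ∀ A B : P.parts, (A.1.card : ℝ) * B.1.card ≤ 4 * n ^ 2 / K ^ 2 := by
    intro A B
    rw [le_div_iff₀ (by positivity)]
    have := mul_le_mul (hcard A.1 A.2) (hcard B.1 B.2) (by positivity) (by positivity)
    linarith
  set c : Finset β → Finset β → ℝ := fun A B => (ε + δ) * (A.card * B.card) +
    if h : A ∈ P.parts ∧ B ∈ P.parts then
      (if R (⟨A, h.1⟩, ⟨B, h.2⟩) then 4 * n ^ 2 / K ^ 2 else 0) else 0 with hc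
  refine (abs_sum_sum_le_of_partition P _ c ?_ S T).trans ?_
  · intro A hA B hB S hS T hT
    simp only [hc, hA, hB, and_self, dif_pos]
    split_ifs with hRAB
    · have h1 := abs_sum_sum_adjInd_sub_le_card G hp0 hp1 hS hT
      have h2 := hsmall ⟨A, hA⟩ ⟨B, hB⟩
      have h3 : 0 ≤ (ε + δ) * ((A.card : ℝ) * B.card) := by positivity
      linarith
    · rw [hR, not_not] at hRAB
      obtain ⟨φ, hu, hv, hgood⟩ := hRAB
      simp only [hbad, not_or, not_not] at hgood
      have hd := hφ (fun a => (φ a).1) (fun a => (φ a).2) fun a b hab =>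
        ⟨fun h => (hgood a b hab).1 (Subtype.ext h), (hgood a b hab).2⟩
      have huAB := (hgood u v huv).2
      rw [hu, hv] at huAB
      simp only [hu, hv] at hd
      have h1 := abs_sum_sum_adjInd_sub_edgeDensity_le G huAB hS hT
      have h2 : ∑ s ∈ S, ∑ t ∈ T, (adjInd G s t - p) =
          ∑ s ∈ S, ∑ t ∈ T, (adjInd G s t - G.edgeDensity A B) +
            (S.card * T.card) * ((G.edgeDensity A B : ℝ) - p) := by
        simp only [Finset.sum_sub_distrib, Finset.sum_const, nsmul_eq_mul]
        ring
      have h3 : (S.card : ℝ) * T.card ≤ A.card * B.card := by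
        exact_mod_cast Nat.mul_le_mul (Finset.card_le_card hS) (Finset.card_le_card hT)
      have h4 : |((S.card : ℝ) * T.card) * ((G.edgeDensity A B : ℝ) - p)| ≤
          (A.card * B.card) * δ := by
        rw [abs_mul, abs_of_nonneg (a := (S.card : ℝ) * T.card) (by positivity)]
        gcongr
      rw [h2, add_zero]
      refine (abs_add_le _ _).trans ?_
      simp only at h1
      linarith
  · have hsum : ∑ A ∈ P.parts, (A.card : ℝ) = n := by
      rw [hn, ← Finset.card_univ, ← P.sum_card_parts, Nat.cast_sum]
    have h1 : ∑ A ∈ P.parts, ∑ B ∈ P.parts, (ε + δ) * ((A.card : ℝ) * B.card) =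
        (ε + δ) * n ^ 2 := by
      simp only [← Finset.mul_sum, ← Finset.sum_mul, hsum]
      ring
    have h2 : ∑ A ∈ P.parts, ∑ B ∈ P.parts,
        (if h : A ∈ P.parts ∧ B ∈ P.parts then
          (if R (⟨A, h.1⟩, ⟨B, h.2⟩) then 4 * n ^ 2 / K ^ 2 else 0) else 0) =
        (univ.filter R).card * (4 * n ^ 2 / K ^ 2) := by
      rw [← nsmul_eq_mul, ← Finset.sum_const, Finset.sum_filter, Fintype.sum_prod_type,
        ← Finset.sum_coe_sort]
      refine Finset.sum_congr rfl fun A _ => ?_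
      rw [← Finset.sum_coe_sort]
      refine Finset.sum_congr rfl fun B _ => ?_
      rw [dif_pos ⟨A.2, B.2⟩]
    simp only [hc, Finset.sum_add_distrib]
    rw [h1, h2]
    have h3 : ((univ.filter R).card : ℝ) * (4 * n ^ 2 / K ^ 2) ≤
        ((N : ℝ) ^ 2 * (2 * ε * K ^ 2)) * (4 * n ^ 2 / K ^ 2) := by gcongr
    have h4 : ((N : ℝ) ^ 2 * (2 * ε * K ^ 2)) * (4 * n ^ 2 / K ^ 2) =
        8 * (N : ℝ) ^ 2 * ε * n ^ 2 := by
      field_simp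
      ring
    linarith

theorem abs_prod_edgeDensity_sub_le {m : ℕ} {β : Type} (G : SimpleGraph β) [DecidableRel G.Adj]
    (E : Finset (Fin m × Fin m)) (hE : ∀ e ∈ E, e.1 < e.2) (A : Fin m → Finset β) {ε q : ℝ}
    (hA : ∀ e ∈ E, G.IsUniform ε (A e.1) (A e.2)) (hpos : 0 < ∏ i, ((A i).card : ℝ))
    (h : |homSum E G A - q * ∏ i, ((A i).card : ℝ)| ≤ ε * ∏ i, ((A i).card : ℝ)) :
    |∏ e ∈ E, (G.edgeDensity (A e.1) (A e.2) : ℝ) - q| ≤ (E.card + 1) * ε := by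
  have h1 := abs_homSum_sub_le G E hE A (fun e => (G.edgeDensity (A e.1) (A e.2) : ℝ))
    (fun e _ => by exact_mod_cast G.edgeDensity_nonneg _ _)
    (fun e _ => by exact_mod_cast G.edgeDensity_le_one _ _) ε
    fun e he S hS T hT => abs_sum_sum_adjInd_sub_edgeDensity_le G (hA e he) hS hT
  refine le_of_mul_le_mul_right ?_ hpos
  rw [← abs_of_pos hpos, ← abs_mul, abs_of_pos hpos]
  rw [abs_le] at h h1 ⊢
  constructor <;> linarith

theorem abs_sum_sum_adjInd_sub_le_of_homSum {m : ℕ} {β : Type} [Fintype β] [DecidableEq β]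
    (G : SimpleGraph β) [DecidableRel G.Adj] (E : Finset (Fin m × Fin m))
    (hE : ∀ e ∈ E, e.1 < e.2) {ε δ p M : ℝ} (hδ : 0 ≤ δ) (hp0 : 0 ≤ p) (hp1 : p ≤ 1)
    (hstab : ∀ D : Fin (m + 4) → Fin (m + 4) → ℝ, (∀ a b, D a b = D b a) → (∀ a b, 0 ≤ D a b) →
      (∀ a b, D a b ≤ 1) →
      (∀ ψ : Fin m → Fin (m + 4), Function.Injective ψ →
        |∏ e ∈ E, D (ψ e.1) (ψ e.2) - p ^ E.card| ≤ (E.card + 1) * ε) →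
      ∀ a b, a ≠ b → |D a b - p| ≤ δ)
    (P : Finpartition (univ : Finset β)) (hPe : P.IsEquipartition) (hPu : P.IsUniform G ε)
    (hK : 1 ≤ ε * P.parts.card) (hKn : P.parts.card ≤ Fintype.card β) {η : ℝ}
    (hη : 2 ≤ η * P.parts.card)
    (hM : ∀ U : Fin m → Finset β, Pairwise (fun i j => Disjoint (U i) (U j)) →
      (∀ i, ((U i).card : ℝ) ≤ η * Fintype.card β) →
      |homSum E G U - p ^ E.card * ∏ i, ((U i).card : ℝ)| ≤ M)
    (hMK : M * (2 * (P.parts.card : ℝ)) ^ m ≤ ε * (Fintype.card β : ℝ) ^ m) (S T : Finset β) :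
    |∑ s ∈ S, ∑ t ∈ T, (adjInd G s t - p)| ≤
      (ε + δ + 8 * ((m + 4 : ℕ) : ℝ) ^ 2 * ε) * (Fintype.card β : ℝ) ^ 2 := by
  have hK0 : 0 < P.parts.card := by
    rcases Nat.eq_zero_or_pos P.parts.card with h | h
    · rw [h] at hK; norm_num at hK
    · exact h
  have hKR : (0 : ℝ) < P.parts.card := by exact_mod_cast hK0
  have hε : 0 < ε := by
    by_contra hneg
    nlinarith [mul_nonneg (neg_nonneg.2 (not_lt.1 hneg)) hKR.le]
  have hub : ∀ A ∈ P.parts, (A.card : ℝ) * P.parts.card ≤ 2 * Fintype.card β := by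
    intro A hA
    have h1 := hPe.card_part_le_average_add_one hA
    rw [Finset.card_univ] at h1
    have h2 := Nat.div_mul_le_self (Fintype.card β) P.parts.card
    have h3 := Nat.mul_le_mul_right P.parts.card h1
    have h4 : A.card * P.parts.card ≤ 2 * Fintype.card β := by linarith
    exact_mod_cast h4
  have hlb : ∀ A ∈ P.parts, (Fintype.card β : ℝ) ≤ 2 * P.parts.card * A.card := by
    intro A hA
    have h1 := hPe.average_le_card_part hA
    rw [Finset.card_univ] at h1
    have h2 := Nat.lt_div_mul_add (a := Fintype.card β) hK0
    have h3 := Nat.mul_le_mul_right P.parts.card h1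
    have h4 : 1 ≤ A.card := (Nat.div_pos hKn hK0).trans_le h1
    have h5 := Nat.mul_le_mul_right P.parts.card h4
    have h6 : Fintype.card β ≤ 2 * P.parts.card * A.card := by linarith
    exact_mod_cast h6
  have hη' : ∀ A ∈ P.parts, (A.card : ℝ) ≤ η * Fintype.card β := by
    intro A hA
    refine le_of_mul_le_mul_right ?_ hKR
    have := mul_le_mul_of_nonneg_right hη (Nat.cast_nonneg (α := ℝ) (Fintype.card β))
    linarith [hub A hA]
  have h01 : (0 : Fin (m + 4)) ≠ 1 := by simp
  refine abs_sum_sum_adjInd_sub_le_of_isUniform G P hPu hK hδ hp0 hp1 hub h01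
    (fun φ hφ hgood => ?_) S T
  refine hstab (fun a b => G.edgeDensity (φ a) (φ b))
    (fun a b => by rw [G.edgeDensity_comm])
    (fun a b => by exact_mod_cast G.edgeDensity_nonneg _ _)
    (fun a b => by exact_mod_cast G.edgeDensity_le_one _ _) (fun ψ hψ => ?_) 0 1 h01
  have hn : (0 : ℝ) < Fintype.card β := by exact_mod_cast hK0.trans_le hKn
  have hApos : ∀ i, (0 : ℝ) < (φ (ψ i)).card := fun i =>
    Nat.cast_pos.2 (Finset.card_pos.2 (P.nonempty_of_mem_parts (hφ _)))
  refine abs_prod_edgeDensity_sub_le G E hE (fun i => φ (ψ i))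
    (fun e he => (hgood _ _ (hψ.ne (hE e he).ne)).2) (Finset.prod_pos fun i _ => hApos i) ?_
  refine (hM _ (fun i j hij => P.disjoint (hφ _) (hφ _) (hgood _ _ (hψ.ne hij)).1)
    fun i => hη' _ (hφ _)).trans ?_
  have hprod : (Fintype.card β : ℝ) ^ m ≤
      (2 * (P.parts.card : ℝ)) ^ m * ∏ i, ((φ (ψ i)).card : ℝ) := by
    have := Finset.prod_le_prod (s := (univ : Finset (Fin m)))
      (fun i _ => hn.le) fun i _ => hlb _ (hφ (ψ i))
    simpa [Finset.prod_mul_distrib, mul_pow] using this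
  have h2K : (0 : ℝ) < (2 * (P.parts.card : ℝ)) ^ m := by positivity
  refine le_of_mul_le_mul_right ?_ h2K
  have := mul_le_mul_of_nonneg_left hprod hε.le
  linarith

/-- The counting property for disjoint sets of prescribed sizes passes to small disjoint sets. -/
theorem SatisfiesP.exists_homSum_le {m : ℕ} {F : SimpleGraph (Fin m)} {p : ℝ} {α : Fin m → ℝ}
    (hα : ∀ i, 0 < α i) (hsum : ∑ i, α i < 1) {V : ℕ → ℕ} {G : ∀ n, SimpleGraph (Fin (V n))}
    (h : SatisfiesP F p α V G) : ∃ η > 0, ∃ ε : ℕ → ℝ, Tendsto ε atTop (nhds 0) ∧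
      ∀ (n : ℕ) (U : Fin m → Finset (Fin (V n))), Pairwise (fun i j => Disjoint (U i) (U j)) →
      (∀ i, ((U i).card : ℝ) ≤ η * V n) →
      |homSum (edgePairs F) (G n) U - p ^ (edgePairs F).card * ∏ i, ((U i).card : ℝ)| ≤
        ε n * (V n : ℝ) ^ m := by
  obtain ⟨a, ha, haα⟩ := exists_pos_forall_le α hα
  obtain ⟨ε, hε, hP⟩ := h
  have heq : ∀ (n : ℕ) (U : Fin m → Finset (Fin (V n))),
      homSum (edgePairs F) (G n) U - p ^ (edgePairs F).card * ∏ i, ((U i).card : ℝ) =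
      ∑ x ∈ Fintype.piFinset U,
        (∏ e ∈ edgePairs F, adjInd (G n) (x e.1) (x e.2) - p ^ (edgePairs F).card) := by
    intro n U
    rw [Finset.sum_sub_distrib, homSum, Finset.sum_const, nsmul_eq_mul, Fintype.card_piFinset]
    push_cast
    ring
  set η := min a (1 - ∑ i, α i) with hη
  refine ⟨η, lt_min ha (by linarith), fun n => 3 ^ m * ε n, by simpa using hε.const_mul (3 ^ m),
    fun n U hU hUη => ?_⟩
  have hV : (0 : ℝ) ≤ V n := Nat.cast_nonneg _
  have hη0 : 0 ≤ η := (lt_min ha (by linarith)).le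
  have key := abs_sum_piFinset_le_of_card_le
    (fun x : Fin m → Fin (V n) =>
      ∏ e ∈ edgePairs F, adjInd (G n) (x e.1) (x e.2) - p ^ (edgePairs F).card)
    (fun i => ⌊α i * (V n : ℝ)⌋₊) ⌊η * (V n : ℝ)⌋₊
    (fun i => Nat.floor_le_floor (mul_le_mul_of_nonneg_right
      ((min_le_left _ _).trans (haα i)) hV)) ?_ (M := ε n * (V n : ℝ) ^ m)
    (fun U hU hUc => by
      rw [← heq, ← labCount_eq_homSum F (G n) U hU, card_edgePairs]
      exact hP n U hU hUc) univ U hU (fun i _ => Nat.le_floor (hUη i))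
    (fun i hi => absurd (mem_univ i) hi)
  · rw [heq]
    simpa [mul_assoc] using key
  · rw [Fintype.card_fin, ← Nat.cast_le (α := ℝ)]
    push_cast
    have h1 : ∑ i, (⌊α i * (V n : ℝ)⌋₊ : ℝ) ≤ (∑ i, α i) * V n := by
      rw [Finset.sum_mul]
      exact Finset.sum_le_sum fun i _ => Nat.floor_le (mul_nonneg (hα i).le hV)
    have h2 : (⌊η * (V n : ℝ)⌋₊ : ℝ) ≤ (1 - ∑ i, α i) * V n :=
      (Nat.floor_le (mul_nonneg hη0 hV)).trans
        (mul_le_mul_of_nonneg_right (min_le_right _ _) hV)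
    linarith

theorem SatisfiesP.cutQuasirandom {m : ℕ} {F : SimpleGraph (Fin m)}
    (hF : (edgePairs F).Nonempty) {p : ℝ} (hp0 : 0 < p) (hp1 : p ≤ 1) {α : Fin m → ℝ}
    (hα : ∀ i, 0 < α i) (hsum : ∑ i, α i < 1) {V : ℕ → ℕ} {G : ∀ n, SimpleGraph (Fin (V n))}
    (hV : Tendsto V atTop atTop) (h : SatisfiesP F p α V G) : CutQuasirandom p V G := by
  classical
  intro γ hγ
  have hE : ∀ e ∈ edgePairs F, e.1 < e.2 := fun e he => (mem_edgePairs.1 he).1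
  obtain ⟨η, hη, ω, hω, hM⟩ := h.exists_homSum_le hα hsum
  obtain ⟨ε₁, hε₁, hstab⟩ := exists_forall_abs_sub_le (m + 4) le_rfl (edgePairs F) hE hF hp0
    (half_pos hγ)
  set N : ℝ := ((m + 4 : ℕ) : ℝ) with hN
  obtain ⟨ε, hε, hεE, hεγ⟩ : ∃ ε > 0, ((edgePairs F).card + 1) * ε ≤ ε₁ ∧
      (1 + 8 * N ^ 2) * ε ≤ γ / 2 := by
    refine ⟨min (ε₁ / ((edgePairs F).card + 1)) (γ / 2 / (1 + 8 * N ^ 2)), by positivity, ?_, ?_⟩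
    · rw [← le_div_iff₀' (by positivity)]
      exact min_le_left _ _
    · rw [← le_div_iff₀' (by positivity)]
      exact min_le_right _ _
  obtain ⟨l, hl⟩ := exists_nat_ge (max (1 / ε) (2 / η))
  set L : ℝ := (SzemerediRegularity.bound ε l : ℝ) with hL
  have hlim : Tendsto (fun n => ω n * (2 * L) ^ m) atTop (nhds 0) := by
    simpa using hω.mul_const ((2 * L) ^ m)
  filter_upwards [hV.eventually_ge_atTop l,
    hV.eventually_ge_atTop (SzemerediRegularity.bound ε l),
    hlim.eventually_le_const hε] with n hnl hnL hωn S T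
  obtain ⟨P, hPe, hPl, hPL, hPu⟩ := szemeredi_regularity (G n) hε
    (hnl.trans_eq (Fintype.card_fin _).symm)
  have hlP : (l : ℝ) ≤ P.parts.card := by exact_mod_cast hPl
  have hPL' : (P.parts.card : ℝ) ≤ L := Nat.cast_le.2 hPL
  have hω0 : 0 ≤ ω n * (V n : ℝ) ^ m :=
    (abs_nonneg _).trans (hM n (fun _ => ∅) (fun _ _ _ => disjoint_empty_left _)
      fun _ => by simpa using mul_nonneg hη.le (Nat.cast_nonneg _))
  have := abs_sum_sum_adjInd_sub_le_of_homSum (G n) (edgePairs F) hE (half_pos hγ).le hp0.le hp1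
    (fun D h1 h2 h3 h4 => hstab D h1 h2 h3 fun ψ hψ => (h4 ψ hψ).trans hεE) P hPe hPu
    ((div_le_iff₀' hε).1 ((le_max_left _ _).trans (hl.trans hlP)))
    (by rw [Fintype.card_fin]; exact hPL.trans hnL)
    ((div_le_iff₀' hη).1 ((le_max_right _ _).trans (hl.trans hlP)))
    (M := ω n * (V n : ℝ) ^ m)
    (fun U hU hUη => hM n U hU (by simpa using hUη)) (by
      rw [Fintype.card_fin]
      calc _ ≤ ω n * (V n : ℝ) ^ m * (2 * L) ^ m := by gcongr
        _ = ω n * (2 * L) ^ m * (V n : ℝ) ^ m := by ring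
        _ ≤ _ := by gcongr) S T
  rw [Fintype.card_fin] at this
  refine this.trans (mul_le_mul_of_nonneg_right ?_ (by positivity))
  linarith
/-- **Theorem A (ii).** If `e(F) > 0`, `0 < p ≤ 1`, the `α_i` are positive with
`∑ α_i < 1`, then `P(F;α₁,…,α_m)` is a `p`-quasi-random property. -/
theorem stmt1 {m : ℕ} (F : SimpleGraph (Fin m)) (hF : 0 < numEdges F)
    (p : ℝ) (hp0 : 0 < p) (hp1 : p ≤ 1)
    (α : Fin m → ℝ) (hα : ∀ i, 0 < α i) (hsum : ∑ i, α i < 1) :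
    ∀ (V : ℕ → ℕ) (G : ∀ n, SimpleGraph (Fin (V n))), Tendsto V atTop atTop →
      (SatisfiesP F p α V G ↔ IsQuasirandom p V G) := by
  have hF' : (edgePairs F).Nonempty := by
    rw [← Finset.card_pos, card_edgePairs]
    exact hF
  have hm : m ≠ 0 := by
    rintro rfl
    obtain ⟨e, -⟩ := hF'
    exact e.1.elim0
  exact fun V G hV =>
    ⟨fun h => (h.cutQuasirandom hF' hp0 hp1 hα hsum hV).isQuasirandom hp0.le hp1 hV,
      fun h => (h.cutQuasirandom hV).satisfiesP hp0.le hp1 hV hm F α hα⟩
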